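/- arXiv:1408.4192 — 4 statements merged into one kernel-verified Lean document; each statement's English description precedes it below -/
import Mathlib

section
/- Let λ1, λ2, μ1, μ2 > 0 with λ1+λ2+μ1+μ2 = 1 and ρ1 + ρ2 < 1, where ρ1 = λ1/μ1, ρ2 = λ2/μ2. Then: (1) if D > 0, then 1 < 1/η1 < 1/b1, T(1/η1) = 0 and T*(1/η1) ≠ 0; (2) if D = 0, then η1 = b1, 1 < 1/b1, and T(1/b1) = 0 and T*(1/b1) = 0; (3) if D < 0, then 1 < 1/η1 < 1/b1, T*(1/η1) = 0 and T(1/η1) ≠ 0. -/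
open Real Filter Topology Set

noncomputable section

/-- The kernel discriminant Δ(y) = (λ+μ1−λ2·y)² − 4λ1μ1 with λ = λ1+λ2. -/
def Delta (l1 l2 m1 y : ℝ) : ℝ := (l1 + l2 + m1 - l2 * y) ^ 2 - 4 * l1 * m1

/-- The small kernel root α(y) = x1(y). -/
def alphaf (l1 l2 m1 y : ℝ) : ℝ :=
  (l1 + l2 + m1 - l2 * y - Real.sqrt (Delta l1 l2 m1 y)) / (2 * l1)

/-- The large kernel root x2(y). -/
def x2f (l1 l2 m1 y : ℝ) : ℝ :=
  (l1 + l2 + m1 - l2 * y + Real.sqrt (Delta l1 l2 m1 y)) / (2 * l1)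

/-- The kernel K(x,y) = λ1(1−x) + λ2(1−y) + μ1(1−1/x). -/
def Kker (l1 l2 m1 x y : ℝ) : ℝ :=
  l1 * (1 - x) + l2 * (1 - y) + m1 * (1 - 1 / x)

/-- A(y) = y·a(y) = λ1·y + λ2·y(1−y) + μ2·(y−1). -/
def Afun (l1 l2 m2 y : ℝ) : ℝ := l1 * y + l2 * y * (1 - y) + m2 * (y - 1)

/-- β(y) = H(y)/H(1) where H(y) = Σ_{k<N} (r2·y)^k and r2 = λ2/(λ1+λ2). -/
def betaf (l1 l2 : ℝ) (N : ℕ) (y : ℝ) : ℝ :=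
  (∑ k ∈ Finset.range N, (l2 / (l1 + l2) * y) ^ k) /
    (∑ k ∈ Finset.range N, (l2 / (l1 + l2) * 1) ^ k)

/-- L3(y) = β(y)(1−ρ1−ρ2). -/
def L3f (l1 l2 m1 m2 : ℝ) (N : ℕ) (y : ℝ) : ℝ :=
  betaf l1 l2 N y * (1 - l1 / m1 - l2 / m2)

/-- L2(y) = [λ1(α(y)−1)+λ2(y−1)]·L3(y)/(A(y)−λ1·y·α(y)). -/
def L2f (l1 l2 m1 m2 : ℝ) (N : ℕ) (y : ℝ) : ℝ :=
  (l1 * (alphaf l1 l2 m1 y - 1) + l2 * (y - 1)) * L3f l1 l2 m1 m2 N y /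
    (Afun l1 l2 m2 y - l1 * y * alphaf l1 l2 m1 y)

/-- L1(x,y) = λ1μ2(x−α(y))(y−1)·L3(y)/(x·K(x,y)·(A(y)−λ1·y·α(y))). -/
def L1f (l1 l2 m1 m2 : ℝ) (N : ℕ) (x y : ℝ) : ℝ :=
  l1 * m2 * (x - alphaf l1 l2 m1 y) * (y - 1) * L3f l1 l2 m1 m2 N y /
    (x * Kker l1 l2 m1 x y * (Afun l1 l2 m2 y - l1 * y * alphaf l1 l2 m1 y))

/-- Λ(y) = α(y)·(y·L2(y)+L3(y))/(x2(y)−x1(y)). -/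
def Lamf (l1 l2 m1 m2 : ℝ) (N : ℕ) (y : ℝ) : ℝ :=
  alphaf l1 l2 m1 y * (y * L2f l1 l2 m1 m2 N y + L3f l1 l2 m1 m2 N y) /
    (x2f l1 l2 m1 y - alphaf l1 l2 m1 y)

/-- b1 = λ2/(λ2+(√μ1−√λ1)²). -/
def b1v (l1 l2 m1 : ℝ) : ℝ := l2 / (l2 + (Real.sqrt m1 - Real.sqrt l1) ^ 2)

/-- b2 = λ2/(λ2+(√μ1+√λ1)²). -/
def b2v (l1 l2 m1 : ℝ) : ℝ := l2 / (l2 + (Real.sqrt m1 + Real.sqrt l1) ^ 2)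

/-- F(y) = λ2·y² − (1−2μ1+μ2)·y + 2μ2. -/
def Ff (l2 m1 m2 y : ℝ) : ℝ := l2 * y ^ 2 - (1 - 2 * m1 + m2) * y + 2 * m2

/-- T*(y) = F(y) + y·√Δ(y). -/
def Tstar (l1 l2 m1 m2 y : ℝ) : ℝ :=
  Ff l2 m1 m2 y + y * Real.sqrt (Delta l1 l2 m1 y)

/-- T(y) = F(y) − y·√Δ(y). -/
def Tm (l1 l2 m1 m2 y : ℝ) : ℝ :=
  Ff l2 m1 m2 y - y * Real.sqrt (Delta l1 l2 m1 y)

/-- η1 = ((1−2μ1) + √((1−2μ1)²+4(μ1−μ2)λ2))/(2μ2). -/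
def eta1 (l2 m1 m2 : ℝ) : ℝ :=
  (1 - 2 * m1 + Real.sqrt ((1 - 2 * m1) ^ 2 + 4 * (m1 - m2) * l2)) / (2 * m2)

/-- η2 = ((1−2μ1) − √((1−2μ1)²+4(μ1−μ2)λ2))/(2μ2). -/
def eta2 (l2 m1 m2 : ℝ) : ℝ :=
  (1 - 2 * m1 - Real.sqrt ((1 - 2 * m1) ^ 2 + 4 * (m1 - m2) * l2)) / (2 * m2)

/-- a = ((1−ρ1−ρ2)/(2μ2))·η1/(η1−η2). -/
def av (l1 l2 m1 m2 : ℝ) : ℝ :=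
  (1 - l1 / m1 - l2 / m2) / (2 * m2) * (eta1 l2 m1 m2 / (eta1 l2 m1 m2 - eta2 l2 m1 m2))

/-- b = ((1−ρ1−ρ2)/(2μ2))·η2/(η2−η1). -/
def bv (l1 l2 m1 m2 : ℝ) : ℝ :=
  (1 - l1 / m1 - l2 / m2) / (2 * m2) * (eta2 l2 m1 m2 / (eta2 l2 m1 m2 - eta1 l2 m1 m2))

/-- ι(y) = (μ1−λ+λ2y−√Δ(y))/(2μ2(y−1)). -/
def iotaf (l1 l2 m1 m2 y : ℝ) : ℝ :=
  (m1 - (l1 + l2) + l2 * y - Real.sqrt (Delta l1 l2 m1 y)) / (2 * m2 * (y - 1))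

/-- κ(y) = (2μ2(1−y) − (1−μ1y)·T(y))/(2μ1μ2·y(1−y)(1−ρ̄1·y)). -/
def kappaf (l1 l2 m1 m2 y : ℝ) : ℝ :=
  (2 * m2 * (1 - y) - (1 - m1 * y) * Tm l1 l2 m1 m2 y) /
    (2 * m1 * m2 * y * (1 - y) * (1 - (l1 + l2) / m1 * y))

/-- c0 = ((λ+μ1) − √((λ+μ1)² − 4λ1μ1))/(2μ1). -/
def c0v (l1 l2 m1 : ℝ) : ℝ :=
  (l1 + l2 + m1 - Real.sqrt ((l1 + l2 + m1) ^ 2 - 4 * l1 * m1)) / (2 * m1)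

/-- c1 = λ2·c0/√((λ+μ1)² − 4λ1μ1). -/
def c1v (l1 l2 m1 : ℝ) : ℝ :=
  l2 * c0v l1 l2 m1 / Real.sqrt ((l1 + l2 + m1) ^ 2 - 4 * l1 * m1)

/-- D = (λ+μ1−2√(λ1μ1))(μ1−μ2−√(λ1μ1)) + λ2μ2. -/
def Dv (l1 l2 m1 m2 : ℝ) : ℝ :=
  (l1 + l2 + m1 - 2 * Real.sqrt (l1 * m1)) * (m1 - m2 - Real.sqrt (l1 * m1)) + l2 * m2

/-- K(η) = λ2·b1·√(1 − b2/b1)/(2·√(b1·b2)·(η − b1)). -/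
def Kcv (l1 l2 m1 η : ℝ) : ℝ :=
  l2 * b1v l1 l2 m1 * Real.sqrt (1 - b2v l1 l2 m1 / b1v l1 l2 m1) /
    (2 * Real.sqrt (b1v l1 l2 m1 * b2v l1 l2 m1) * (η - b1v l1 l2 m1))

/-- σ(η) = K(η)/(b1·√π). -/
def sigmav (l1 l2 m1 η : ℝ) : ℝ :=
  Kcv l1 l2 m1 η / (b1v l1 l2 m1 * Real.sqrt Real.pi)

/-- K1(η). -/
def K1v (l1 l2 m1 m2 η : ℝ) : ℝ :=
  l2 * b1v l1 l2 m1 * Real.sqrt (1 - b2v l1 l2 m1 / b1v l1 l2 m1) *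
      ((1 - m1 / b1v l1 l2 m1) * (Ff l2 m1 m2 (1 / b1v l1 l2 m1) + 1)
        - 2 * m2 * (1 - 1 / b1v l1 l2 m1)) /
    (4 * m1 * m2 * Real.sqrt (b1v l1 l2 m1 * b2v l1 l2 m1) * (1 - η / b1v l1 l2 m1) *
      (1 - 1 / b1v l1 l2 m1) * (1 - (l1 + l2) / m1 / b1v l1 l2 m1))

/-- σ1(η) = K1(η)/(b1·√π). -/
def sigma1v (l1 l2 m1 m2 η : ℝ) : ℝ :=
  K1v l1 l2 m1 m2 η / (b1v l1 l2 m1 * Real.sqrt Real.pi)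

/-- The product `T · T*` factors through `1 - y` and a quadratic whose reciprocal roots are
`η1` and `η2`. -/
lemma Ff_sq_sub_Delta {l1 l2 m1 m2 : ℝ} (hsum : l1 + l2 + m1 + m2 = 1) (y : ℝ) :
    Ff l2 m1 m2 y ^ 2 - y ^ 2 * Delta l1 l2 m1 y =
      4 * (1 - y) * (m2 ^ 2 - m2 * (1 - 2 * m1) * y - (m1 - m2) * l2 * y ^ 2) := by
  obtain rfl : l1 = 1 - l2 - m1 - m2 := by linarith
  unfold Ff Delta
  ring

lemma quadratic_eq_eta_factors {l2 m1 m2 : ℝ} (hm2 : m2 ≠ 0)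
    (hdisc : 0 ≤ (1 - 2 * m1) ^ 2 + 4 * (m1 - m2) * l2) (t : ℝ) :
    m2 ^ 2 * t ^ 2 - m2 * (1 - 2 * m1) * t - (m1 - m2) * l2 =
      m2 ^ 2 * ((t - eta1 l2 m1 m2) * (t - eta2 l2 m1 m2)) := by
  have hsq := Real.sq_sqrt hdisc
  unfold eta1 eta2
  generalize Real.sqrt ((1 - 2 * m1) ^ 2 + 4 * (m1 - m2) * l2) = d at hsq ⊢
  field_simp
  linear_combination hsq

lemma Ff_sq_sub_Delta_eq_eta_factors {l1 l2 m1 m2 : ℝ} (hsum : l1 + l2 + m1 + m2 = 1)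
    (hm2 : m2 ≠ 0) (hdisc : 0 ≤ (1 - 2 * m1) ^ 2 + 4 * (m1 - m2) * l2) {y : ℝ} (hy : y ≠ 0) :
    Ff l2 m1 m2 y ^ 2 - y ^ 2 * Delta l1 l2 m1 y =
      4 * (1 - y) * (y ^ 2 * (m2 ^ 2 * ((1 / y - eta1 l2 m1 m2) * (1 / y - eta2 l2 m1 m2)))) := by
  rw [Ff_sq_sub_Delta hsum, ← quadratic_eq_eta_factors hm2 hdisc]
  field_simp

lemma eta2_le_eta1 {l2 m1 m2 : ℝ} (hm2 : 0 < m2) : eta2 l2 m1 m2 ≤ eta1 l2 m1 m2 := by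
  unfold eta1 eta2
  gcongr
  linarith [Real.sqrt_nonneg ((1 - 2 * m1) ^ 2 + 4 * (m1 - m2) * l2)]

lemma eta1_add_eta2 {l2 m1 m2 : ℝ} (hm2 : m2 ≠ 0) :
    m2 * (eta1 l2 m1 m2 + eta2 l2 m1 m2) = 1 - 2 * m1 := by
  unfold eta1 eta2
  field_simp
  ring

/-- The stability condition forces `η1 < 1`. -/
lemma eta1_lt_one {l1 l2 m1 m2 : ℝ} (hm2 : 0 < m2)
    (hsum : l1 + l2 + m1 + m2 = 1) (h1 : l1 < m1) (h2 : l2 < m2)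
    (hr : l1 * m2 + l2 * m1 < m1 * m2)
    (hdisc : 0 ≤ (1 - 2 * m1) ^ 2 + 4 * (m1 - m2) * l2) : eta1 l2 m1 m2 < 1 := by
  have hone := quadratic_eq_eta_factors hm2.ne' hdisc 1
  have hpos : 0 < m2 ^ 2 * 1 ^ 2 - m2 * (1 - 2 * m1) * 1 - (m1 - m2) * l2 := by
    obtain rfl : l1 = 1 - l2 - m1 - m2 := by linarith
    nlinarith
  rw [hone] at hpos
  have hprod := pos_of_mul_pos_right hpos (by positivity)
  have hadd := eta1_add_eta2 (l2 := l2) (m1 := m1) hm2.ne'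
  have hlt : eta1 l2 m1 m2 + eta2 l2 m1 m2 < 2 := by
    by_contra! h
    nlinarith
  by_contra! h
  nlinarith

lemma one_div_b1v {l1 l2 m1 : ℝ} (hl1 : 0 ≤ l1) (hm1 : 0 ≤ m1) :
    1 / b1v l1 l2 m1 = (l1 + l2 + m1 - 2 * Real.sqrt (l1 * m1)) / l2 := by
  unfold b1v
  rw [one_div_div, Real.sqrt_mul hl1]
  congr 1
  linear_combination Real.sq_sqrt hl1 + Real.sq_sqrt hm1

lemma one_lt_one_div_b1v {l1 l2 m1 : ℝ} (hl2 : 0 < l2) (hl1 : 0 ≤ l1) (h : l1 < m1) :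
    1 < 1 / b1v l1 l2 m1 := by
  have hs := Real.sqrt_lt_sqrt hl1 h
  have : 0 < (Real.sqrt m1 - Real.sqrt l1) ^ 2 := pow_pos (sub_pos.mpr hs) 2
  unfold b1v
  rw [one_div_div, one_lt_div hl2]
  linarith

lemma b1v_pos {l1 l2 m1 : ℝ} (hl2 : 0 < l2) : 0 < b1v l1 l2 m1 := by
  unfold b1v
  positivity

/-- `1 / b1` is a branch point. -/
lemma Delta_one_div_b1v {l1 l2 m1 : ℝ} (hl1 : 0 ≤ l1) (hl2 : l2 ≠ 0) (hm1 : 0 ≤ m1) :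
    Delta l1 l2 m1 (1 / b1v l1 l2 m1) = 0 := by
  rw [one_div_b1v hl1 hm1, Delta, mul_div_cancel₀ _ hl2]
  linear_combination 4 * Real.sq_sqrt (mul_nonneg hl1 hm1)

/-- The discriminant is positive to the left of `1 / b1`. -/
lemma Delta_pos_of_lt {l1 l2 m1 y : ℝ} (hl1 : 0 ≤ l1) (hl2 : 0 < l2) (hm1 : 0 ≤ m1)
    (hy : y < 1 / b1v l1 l2 m1) : 0 < Delta l1 l2 m1 y := by
  rw [one_div_b1v hl1 hm1, lt_div_iff₀ hl2] at hy
  have hsq := Real.sq_sqrt (mul_nonneg hl1 hm1)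
  have hnn := Real.sqrt_nonneg (l1 * m1)
  unfold Delta
  nlinarith

/-- The sign of `F` at the branch point `1 / b1` is the sign of `D`. -/
lemma Ff_one_div_b1v {l1 l2 m1 m2 : ℝ} (hl1 : 0 ≤ l1) (hl2 : l2 ≠ 0) (hm1 : 0 ≤ m1)
    (hsum : l1 + l2 + m1 + m2 = 1) :
    Ff l2 m1 m2 (1 / b1v l1 l2 m1) = 2 * Dv l1 l2 m1 m2 / l2 := by
  rw [one_div_b1v hl1 hm1, Ff, Dv]
  generalize Real.sqrt (l1 * m1) = r
  obtain rfl : l1 = 1 - l2 - m1 - m2 := by linarith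
  field_simp
  ring

/-- At the branch point the quadratic defining `η1` is, up to a negative factor, `D ^ 2`. -/
lemma b1v_eta_factors {l1 l2 m1 m2 : ℝ} (hl1 : 0 ≤ l1) (hl2 : 0 < l2) (hm1 : 0 ≤ m1)
    (hsum : l1 + l2 + m1 + m2 = 1) :
    (2 * Dv l1 l2 m1 m2 / l2) ^ 2 =
      4 * (1 - 1 / b1v l1 l2 m1) * ((1 / b1v l1 l2 m1) ^ 2 *
        (m2 ^ 2 * b1v l1 l2 m1 ^ 2 - m2 * (1 - 2 * m1) * b1v l1 l2 m1 - (m1 - m2) * l2)) := by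
  have h := Ff_sq_sub_Delta hsum (1 / b1v l1 l2 m1)
  rw [Delta_one_div_b1v hl1 hl2.ne' hm1, Ff_one_div_b1v hl1 hl2.ne' hm1 hsum, mul_zero,
    sub_zero] at h
  rw [h]
  have := (b1v_pos (l1 := l1) (m1 := m1) hl2).ne'
  field_simp

lemma quadratic_b1v_nonpos {l1 l2 m1 m2 : ℝ} (hl1 : 0 ≤ l1) (hl2 : 0 < l2) (h : l1 < m1)
    (hsum : l1 + l2 + m1 + m2 = 1) :
    m2 ^ 2 * b1v l1 l2 m1 ^ 2 - m2 * (1 - 2 * m1) * b1v l1 l2 m1 - (m1 - m2) * l2 ≤ 0 := by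
  have hid := b1v_eta_factors hl1 hl2 (hl1.trans h.le) hsum
  have hb := one_lt_one_div_b1v hl2 hl1 h
  by_contra! hpos
  have : 0 < (1 / b1v l1 l2 m1) ^ 2 *
      (m2 ^ 2 * b1v l1 l2 m1 ^ 2 - m2 * (1 - 2 * m1) * b1v l1 l2 m1 - (m1 - m2) * l2) := by
    positivity
  nlinarith [sq_nonneg (2 * Dv l1 l2 m1 m2 / l2)]

lemma eta_discriminant_nonneg {l1 l2 m1 m2 : ℝ} (hl1 : 0 ≤ l1) (hl2 : 0 < l2) (h : l1 < m1)
    (hsum : l1 + l2 + m1 + m2 = 1) : 0 ≤ (1 - 2 * m1) ^ 2 + 4 * (m1 - m2) * l2 := by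
  nlinarith [quadratic_b1v_nonpos hl1 hl2 h hsum,
    sq_nonneg (2 * m2 * b1v l1 l2 m1 - (1 - 2 * m1))]

/-- Away from `D = 0`, the point `b1` lies strictly between `η2` and `η1`. -/
lemma b1v_mem_Ioo {l1 l2 m1 m2 : ℝ} (hl1 : 0 ≤ l1) (hl2 : 0 < l2) (h : l1 < m1) (hm2 : 0 < m2)
    (hsum : l1 + l2 + m1 + m2 = 1) (hD : Dv l1 l2 m1 m2 ≠ 0) :
    b1v l1 l2 m1 ∈ Ioo (eta2 l2 m1 m2) (eta1 l2 m1 m2) := by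
  have hdisc := eta_discriminant_nonneg hl1 hl2 h hsum
  have hle := quadratic_b1v_nonpos hl1 hl2 h hsum
  have hne : m2 ^ 2 * b1v l1 l2 m1 ^ 2 - m2 * (1 - 2 * m1) * b1v l1 l2 m1 - (m1 - m2) * l2
      ≠ 0 := by
    intro h0
    have hid := b1v_eta_factors hl1 hl2 (hl1.trans h.le) hsum
    rw [h0, mul_zero, mul_zero] at hid
    have : 2 * Dv l1 l2 m1 m2 / l2 ≠ 0 := by positivity
    exact this (pow_eq_zero_iff two_ne_zero |>.mp hid)
  have hlt := lt_of_le_of_ne hle hne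
  rw [quadratic_eq_eta_factors hm2.ne' hdisc] at hlt
  have hprod := neg_of_mul_neg_right hlt (by positivity)
  have h12 := eta2_le_eta1 (l2 := l2) (m1 := m1) hm2
  constructor <;> by_contra! hc <;> nlinarith

/-- When `D = 0`, the dominant singularity merges with the branch point. -/
lemma eta1_eq_b1v {l1 l2 m1 m2 : ℝ} (hl1 : 0 ≤ l1) (hl2 : 0 < l2) (h : l1 < m1) (hm2 : 0 < m2)
    (hsum : l1 + l2 + m1 + m2 = 1) (hD : Dv l1 l2 m1 m2 = 0) :
    eta1 l2 m1 m2 = b1v l1 l2 m1 := by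
  have hm1 : 0 < m1 := hl1.trans_lt h
  have hdisc := eta_discriminant_nonneg hl1 hl2 h hsum
  have hid := b1v_eta_factors hl1 hl2 hm1.le hsum
  have hb := one_lt_one_div_b1v hl2 hl1 h
  have hb0 := b1v_pos (l1 := l1) (m1 := m1) hl2
  rw [hD, quadratic_eq_eta_factors hm2.ne' hdisc] at hid
  have hne : 1 - 1 / b1v l1 l2 m1 ≠ 0 := by linarith
  have hroot : b1v l1 l2 m1 - eta1 l2 m1 m2 = 0 ∨ b1v l1 l2 m1 - eta2 l2 m1 m2 = 0 := by
    rw [mul_zero, zero_div, zero_pow two_ne_zero, zero_eq_mul,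
      or_iff_right (mul_ne_zero four_ne_zero hne)] at hid
    simpa [hm2.ne', hb0.ne'] using hid
  have hvertex : 1 - 2 * m1 ≤ 2 * m2 * b1v l1 l2 m1 := by
    have hs := Real.sqrt_lt_sqrt hl1 h
    have hs1 := Real.sq_sqrt hl1
    have ht1 := Real.sq_sqrt hm1.le
    have hs0 := Real.sqrt_nonneg l1
    have hb1 : b1v l1 l2 m1 = l2 / (l2 + (Real.sqrt m1 - Real.sqrt l1) ^ 2) := rfl
    unfold Dv at hD
    rw [Real.sqrt_mul hl1] at hD
    generalize Real.sqrt l1 = s at *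
    generalize Real.sqrt m1 = t at *
    subst hs1 ht1
    have hc : (l2 + (t - s) ^ 2) * t = (t - s) * m2 :=
      mul_left_cancel₀ (sub_pos.mpr hs).ne' (by linear_combination hD)
    have hcpos : 0 < l2 + (t - s) ^ 2 := by positivity
    have hcm : l2 + (t - s) ^ 2 ≤ m2 := by
      by_contra! hge
      nlinarith [mul_pos (sub_pos.mpr hge) (hs0.trans_lt hs), mul_nonneg hs0 hm2.le]
    have hbval : m2 * b1v (s ^ 2) l2 (t ^ 2) = m2 + s * t - t ^ 2 := by
      rw [hb1]
      field_simp
      linear_combination hD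
    nlinarith
  rcases hroot with h1 | h2
  · linarith
  · have hadd := eta1_add_eta2 (l2 := l2) (m1 := m1) hm2.ne'
    have h12 := eta2_le_eta1 (l2 := l2) (m1 := m1) hm2
    nlinarith

/-- `F` does not vanish on `(1 / η1, 1 / b1]`. -/
lemma Ff_ne_zero {l1 l2 m1 m2 y : ℝ} (hl1 : 0 ≤ l1) (hl2 : 0 < l2) (h : l1 < m1) (hm2 : 0 < m2)
    (hsum : l1 + l2 + m1 + m2 = 1) (hD : Dv l1 l2 m1 m2 ≠ 0) (hy1 : 1 < y)
    (hy : 1 / eta1 l2 m1 m2 < y) (hyb : y ≤ 1 / b1v l1 l2 m1) : Ff l2 m1 m2 y ≠ 0 := by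
  intro h0
  have hdisc := eta_discriminant_nonneg hl1 hl2 h hsum
  obtain ⟨h2b, hb1⟩ := b1v_mem_Ioo hl1 hl2 h hm2 hsum hD
  have hb0 := b1v_pos (l1 := l1) (m1 := m1) hl2
  have hypos : 0 < y := by linarith
  have hDelta : 0 ≤ Delta l1 l2 m1 y := by
    rcases hyb.lt_or_eq with hlt | heq
    · exact (Delta_pos_of_lt hl1 hl2 (hl1.trans h.le) hlt).le
    · rw [heq, Delta_one_div_b1v hl1 hl2.ne' (hl1.trans h.le)]
  have hlt1 : 1 / y < eta1 l2 m1 m2 := (one_div_lt (hb0.trans hb1) hypos).mp hy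
  have hlt2 : eta2 l2 m1 m2 < 1 / y := h2b.trans_le ((le_one_div hypos hb0).mp hyb)
  have hid := Ff_sq_sub_Delta_eq_eta_factors hsum hm2.ne' hdisc hypos.ne'
  have hneg : (1 / y - eta1 l2 m1 m2) * (1 / y - eta2 l2 m1 m2) < 0 :=
    mul_neg_of_neg_of_pos (by linarith) (by linarith)
  have hneg' : y ^ 2 * (m2 ^ 2 * ((1 / y - eta1 l2 m1 m2) * (1 / y - eta2 l2 m1 m2))) < 0 :=
    mul_neg_of_pos_of_neg (by positivity) (mul_neg_of_pos_of_neg (by positivity) hneg)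
  have hpos := mul_pos_of_neg_of_neg (by linarith : 4 * (1 - y) < 0) hneg'
  rw [← hid, h0] at hpos
  nlinarith [mul_nonneg (sq_nonneg y) hDelta]

/-- At `1 / η1` the number `F` has the absolute value `y √Δ`, and the sign of `D`. -/
lemma Ff_one_div_eta1 {l1 l2 m1 m2 : ℝ} (hl1 : 0 ≤ l1) (hl2 : 0 < l2) (h1 : l1 < m1)
    (h2 : l2 < m2) (hsum : l1 + l2 + m1 + m2 = 1) (hr : l1 * m2 + l2 * m1 < m1 * m2)
    (hD : Dv l1 l2 m1 m2 ≠ 0) :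
    1 < 1 / eta1 l2 m1 m2 ∧ 1 / eta1 l2 m1 m2 < 1 / b1v l1 l2 m1 ∧
      0 < 1 / eta1 l2 m1 m2 * Real.sqrt (Delta l1 l2 m1 (1 / eta1 l2 m1 m2)) ∧
      Ff l2 m1 m2 (1 / eta1 l2 m1 m2) ^ 2 =
        (1 / eta1 l2 m1 m2 * Real.sqrt (Delta l1 l2 m1 (1 / eta1 l2 m1 m2))) ^ 2 ∧
      0 < Ff l2 m1 m2 (1 / eta1 l2 m1 m2) * Dv l1 l2 m1 m2 := by
  have hm2 := hl2.trans h2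
  have hm1 := hl1.trans h1.le
  have hdisc := eta_discriminant_nonneg hl1 hl2 h1 hsum
  have hb := (b1v_mem_Ioo hl1 hl2 h1 hm2 hsum hD).2
  have hb0 := b1v_pos (l1 := l1) (m1 := m1) hl2
  have he0 := hb0.trans hb
  have hone : 1 < 1 / eta1 l2 m1 m2 :=
    (one_lt_div he0).mpr (eta1_lt_one hm2 hsum h1 h2 hr hdisc)
  have hlt : 1 / eta1 l2 m1 m2 < 1 / b1v l1 l2 m1 := one_div_lt_one_div_of_lt hb0 hb
  have hDelta := Delta_pos_of_lt hl1 hl2 hm1 hlt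
  have hpos : 0 < 1 / eta1 l2 m1 m2 * Real.sqrt (Delta l1 l2 m1 (1 / eta1 l2 m1 m2)) := by
    have := Real.sqrt_pos.mpr hDelta
    positivity
  have hsq : Ff l2 m1 m2 (1 / eta1 l2 m1 m2) ^ 2 =
      (1 / eta1 l2 m1 m2 * Real.sqrt (Delta l1 l2 m1 (1 / eta1 l2 m1 m2))) ^ 2 := by
    have hid := Ff_sq_sub_Delta_eq_eta_factors hsum hm2.ne' hdisc
      (one_div_pos.mpr he0).ne'
    rw [one_div_one_div, sub_self, zero_mul, mul_zero, mul_zero, mul_zero] at hid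
    rw [mul_pow, Real.sq_sqrt hDelta.le]
    linarith
  refine ⟨hone, hlt, hpos, hsq, ?_⟩
  have hcont : ContinuousOn (fun y => Ff l2 m1 m2 y * Dv l1 l2 m1 m2)
      (Icc (1 / eta1 l2 m1 m2) (1 / b1v l1 l2 m1)) := by
    unfold Ff
    fun_prop
  by_contra! hle
  have hend : 0 ≤ Ff l2 m1 m2 (1 / b1v l1 l2 m1) * Dv l1 l2 m1 m2 := by
    rw [Ff_one_div_b1v hl1 hl2.ne' hm1 hsum]
    have : 2 * Dv l1 l2 m1 m2 / l2 * Dv l1 l2 m1 m2 = 2 * Dv l1 l2 m1 m2 ^ 2 / l2 := by ring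
    rw [this]
    positivity
  obtain ⟨z, ⟨hz1, hz2⟩, hz⟩ := intermediate_value_Icc hlt.le hcont ⟨hle, hend⟩
  have hFz : Ff l2 m1 m2 z = 0 := (mul_eq_zero.mp hz).resolve_right hD
  rcases hz1.eq_or_lt with rfl | hz1
  · rw [hFz] at hsq
    nlinarith
  · exact Ff_ne_zero hl1 hl2 h1 hm2 hsum hD (hone.trans hz1) hz1 hz2 hFz

/-- The Key Lemma: location and nature of the dominant singularity according
to the sign of `D`. -/
theorem stmt13 (l1 l2 m1 m2 : ℝ) (hl1 : 0 < l1) (hl2 : 0 < l2) (hm1 : 0 < m1) (hm2 : 0 < m2)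
    (hsum : l1 + l2 + m1 + m2 = 1) (hr : l1 / m1 + l2 / m2 < 1) :
    (0 < Dv l1 l2 m1 m2 →
      1 < 1 / eta1 l2 m1 m2 ∧ 1 / eta1 l2 m1 m2 < 1 / b1v l1 l2 m1 ∧
      Tm l1 l2 m1 m2 (1 / eta1 l2 m1 m2) = 0 ∧
      Tstar l1 l2 m1 m2 (1 / eta1 l2 m1 m2) ≠ 0) ∧
    (Dv l1 l2 m1 m2 = 0 →
      eta1 l2 m1 m2 = b1v l1 l2 m1 ∧ 1 < 1 / b1v l1 l2 m1 ∧
      Tm l1 l2 m1 m2 (1 / b1v l1 l2 m1) = 0 ∧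
      Tstar l1 l2 m1 m2 (1 / b1v l1 l2 m1) = 0) ∧
    (Dv l1 l2 m1 m2 < 0 →
      1 < 1 / eta1 l2 m1 m2 ∧ 1 / eta1 l2 m1 m2 < 1 / b1v l1 l2 m1 ∧
      Tstar l1 l2 m1 m2 (1 / eta1 l2 m1 m2) = 0 ∧
      Tm l1 l2 m1 m2 (1 / eta1 l2 m1 m2) ≠ 0) := by
  have h1 : l1 < m1 := by
    rw [← div_lt_one hm1]
    linarith [div_pos hl2 hm2]
  have h2 : l2 < m2 := by
    rw [← div_lt_one hm2]
    linarith [div_pos hl1 hm1]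
  have hr' : l1 * m2 + l2 * m1 < m1 * m2 := by
    rw [div_add_div _ _ hm1.ne' hm2.ne', div_lt_one (mul_pos hm1 hm2)] at hr
    linarith
  refine ⟨fun hD => ?_, fun hD => ?_, fun hD => ?_⟩
  · obtain ⟨hone, hlt, hpos, hsq, hsign⟩ :=
      Ff_one_div_eta1 hl1.le hl2 h1 h2 hsum hr' hD.ne'
    have hF := pos_of_mul_pos_left hsign hD.le
    refine ⟨hone, hlt, ?_, ?_⟩
    · exact sub_eq_zero.mpr ((sq_eq_sq₀ hF.le hpos.le).mp hsq)
    · exact (add_pos hF hpos).ne'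
  · refine ⟨eta1_eq_b1v hl1.le hl2 h1 hm2 hsum hD, one_lt_one_div_b1v hl2 hl1.le h1, ?_, ?_⟩
    · rw [Tm, Delta_one_div_b1v hl1.le hl2.ne' hm1.le,
        Ff_one_div_b1v hl1.le hl2.ne' hm1.le hsum, hD]
      simp
    · rw [Tstar, Delta_one_div_b1v hl1.le hl2.ne' hm1.le,
        Ff_one_div_b1v hl1.le hl2.ne' hm1.le hsum, hD]
      simp
  · obtain ⟨hone, hlt, hpos, hsq, hsign⟩ :=
      Ff_one_div_eta1 hl1.le hl2 h1 h2 hsum hr' hD.ne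
    have hF := neg_of_mul_pos_left hsign hD.le
    refine ⟨hone, hlt, ?_, ?_⟩
    · rcases sq_eq_sq_iff_eq_or_eq_neg.mp hsq with h | h
      · linarith
      · exact add_eq_zero_iff_eq_neg.mpr h
    · exact (sub_neg.mpr (hF.trans hpos)).ne

end
end

section
/- Let λ1, λ2, μ1, μ2 > 0 with λ1+λ2+μ1+μ2 = 1 and ρ1 + ρ2 < 1, where ρ1 = λ1/μ1, ρ2 = λ2/μ2, assume η1 ≠ η2, and let N ≥ 1 be an integer. Then for every y ∈ (0,1) with Δ(y) ≥ 0, T(y) ≠ 0, (1−η1·y)(1−η2·y) ≠ 0 and A(y) − λ1·y·α(y) ≠ 0: L2(y) = [ a·T*(y)/(1−η1·y) + b·T*(y)/(1−η2·y) ]·ι(y)·β(y). -/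
open Real Filter Topology Set

noncomputable section

/-- The factorization of the product of the two conjugate denominators through `η1` and `η2`. -/
theorem Tm_mul_Tstar {l1 l2 m1 m2 y : ℝ} (hm2 : m2 ≠ 0) (hsum : l1 + l2 + m1 + m2 = 1)
    (hD : 0 ≤ (1 - 2 * m1) ^ 2 + 4 * (m1 - m2) * l2) (hy : 0 ≤ Delta l1 l2 m1 y) :
    Tm l1 l2 m1 m2 y * Tstar l1 l2 m1 m2 y =
      4 * m2 ^ 2 * (1 - y) * ((1 - eta1 l2 m1 m2 * y) * (1 - eta2 l2 m1 m2 * y)) := by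
  have hS := Real.sq_sqrt hy
  have hE := Real.sq_sqrt hD
  have hl1 : l1 = 1 - l2 - m1 - m2 := by linarith
  unfold Tm Tstar eta1 eta2
  generalize √(Delta l1 l2 m1 y) = s at hS ⊢
  generalize √((1 - 2 * m1) ^ 2 + 4 * (m1 - m2) * l2) = e at hE ⊢
  unfold Delta at hS
  unfold Ff
  subst hl1
  field_simp
  linear_combination (-4 * y ^ 2) * hS + 4 * (1 - y) * y ^ 2 * hE

/-- The denominator of `L2f` is `-T(y) / 2`. -/
theorem Afun_sub_eq {l1 l2 m1 m2 y : ℝ} (hl1 : l1 ≠ 0) (hsum : l1 + l2 + m1 + m2 = 1) :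
    Afun l1 l2 m2 y - l1 * y * alphaf l1 l2 m1 y = -Tm l1 l2 m1 m2 y / 2 := by
  unfold Afun alphaf Tm Ff
  field_simp
  linear_combination y * hsum

/-- The numerator of `L2f` in terms of `ι`. -/
theorem numerator_eq_iotaf {l1 l2 m1 m2 y : ℝ} (hl1 : l1 ≠ 0) (hm2 : m2 ≠ 0) (hy : y - 1 ≠ 0) :
    l1 * (alphaf l1 l2 m1 y - 1) + l2 * (y - 1) = m2 * (y - 1) * iotaf l1 l2 m1 m2 y := by
  unfold alphaf iotaf
  field_simp
  ring

/-- Recombination of the two partial fractions. -/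
theorem av_div_add_bv_div {l1 l2 m1 m2 y t : ℝ} (hne : eta1 l2 m1 m2 ≠ eta2 l2 m1 m2)
    (h1 : 1 - eta1 l2 m1 m2 * y ≠ 0) (h2 : 1 - eta2 l2 m1 m2 * y ≠ 0) :
    av l1 l2 m1 m2 * t / (1 - eta1 l2 m1 m2 * y) + bv l1 l2 m1 m2 * t / (1 - eta2 l2 m1 m2 * y) =
      (1 - l1 / m1 - l2 / m2) / (2 * m2) *
        (t / ((1 - eta1 l2 m1 m2 * y) * (1 - eta2 l2 m1 m2 * y))) := by
  unfold av bv
  generalize (1 - l1 / m1 - l2 / m2) / (2 * m2) = c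
  generalize eta1 l2 m1 m2 = p at *
  generalize eta2 l2 m1 m2 = q at *
  have h3 : p - q ≠ 0 := sub_ne_zero.2 hne
  rw [← neg_sub p q]
  field_simp
  ring

/-- Proposition 7: the partial-fraction representation of `L2`. -/
theorem stmt14 (l1 l2 m1 m2 : ℝ) (hl1 : 0 < l1) (hl2 : 0 < l2) (hm1 : 0 < m1) (hm2 : 0 < m2)
    (hsum : l1 + l2 + m1 + m2 = 1) (hr : l1 / m1 + l2 / m2 < 1)
    (hne : eta1 l2 m1 m2 ≠ eta2 l2 m1 m2) (N : ℕ) (hN : 1 ≤ N) :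
    ∀ y ∈ Ioo (0:ℝ) 1, 0 ≤ Delta l1 l2 m1 y → Tm l1 l2 m1 m2 y ≠ 0 →
      (1 - eta1 l2 m1 m2 * y) * (1 - eta2 l2 m1 m2 * y) ≠ 0 →
      Afun l1 l2 m2 y - l1 * y * alphaf l1 l2 m1 y ≠ 0 →
      L2f l1 l2 m1 m2 N y
        = (av l1 l2 m1 m2 * Tstar l1 l2 m1 m2 y / (1 - eta1 l2 m1 m2 * y)
            + bv l1 l2 m1 m2 * Tstar l1 l2 m1 m2 y / (1 - eta2 l2 m1 m2 * y))
          * iotaf l1 l2 m1 m2 y * betaf l1 l2 N y := by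
  intro y hy hDelta hT hP _
  have hy1 : y - 1 ≠ 0 := by linarith [hy.2]
  have hD : 0 ≤ (1 - 2 * m1) ^ 2 + 4 * (m1 - m2) * l2 := by
    by_contra! h
    exact hne (by simp [eta1, eta2, Real.sqrt_eq_zero_of_nonpos h.le])
  have hprod := Tm_mul_Tstar hm2.ne' hsum hD hDelta
  rw [av_div_add_bv_div hne (left_ne_zero_of_mul hP) (right_ne_zero_of_mul hP), L2f, L3f,
    Afun_sub_eq hl1.ne' hsum, numerator_eq_iotaf hl1.ne' hm2.ne' hy1]
  have hq : Tstar l1 l2 m1 m2 y / ((1 - eta1 l2 m1 m2 * y) * (1 - eta2 l2 m1 m2 * y)) =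
      4 * m2 ^ 2 * (1 - y) / Tm l1 l2 m1 m2 y := by
    rw [div_eq_div_iff hP hT]
    linear_combination hprod
  rw [hq]
  generalize 1 - l1 / m1 - l2 / m2 = c
  field_simp
  ring

end
end

section
/- Let λ1, λ2, μ1, μ2 > 0 with λ1+λ2+μ1+μ2 = 1 and ρ1 + ρ2 < 1, where ρ1 = λ1/μ1, ρ2 = λ2/μ2, and let N ≥ 1 be an integer. Let η ∈ {η1, η2} satisfy: (i) η ≠ 0; (ii) η ≠ b1; (iii) |η| < b1 or T*(1/η) = 0. Let g(y) = T*(y)·ι(y)·β(y)/(1−η·y), a function real-analytic in a neighborhood of 0, and let g_n = g⁽ⁿ⁾(0)/n! be its n-th Taylor coefficient at 0. Then g_n / (n^{−3/2}·b1^n) → b1·β(1/b1)·σ(η) as n → ∞, where σ(η) = K(η)/(b1·√π) and K(η) = λ2·b1·√(1 − b2/b1) / (2·√(b1·b2)·(η − b1)). -/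
open Real Filter Topology Set

noncomputable section

/-- The `n`-th Taylor coefficient of `√(1 - x)` at `0`. -/
def sqrtCoeff (n : ℕ) : ℝ := (∏ j ∈ Finset.range n, (-1 / 2 + (j : ℝ))) / (n.factorial : ℝ)

lemma sqrtCoeff_succ (n : ℕ) :
    sqrtCoeff (n + 1) = sqrtCoeff n * ((n - 1 / 2) / (n + 1)) := by
  have h : (n.factorial : ℝ) ≠ 0 := by positivity
  have h' : (n : ℝ) + 1 ≠ 0 := by positivity
  simp only [sqrtCoeff, Finset.prod_range_succ, Nat.factorial_succ]
  push_cast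
  field_simp
  ring

lemma sqrtCoeff_succ_neg (n : ℕ) : sqrtCoeff (n + 1) < 0 := by
  induction n with
  | zero => norm_num [sqrtCoeff]
  | succ n ih =>
    rw [sqrtCoeff_succ]
    apply mul_neg_of_neg_of_pos ih
    push_cast
    apply div_pos <;> linarith [Nat.cast_nonneg (α := ℝ) n]

lemma sqrtCoeff_diff (n : ℕ) :
    sqrtCoeff (n + 1) - sqrtCoeff n = -sqrtCoeff n * (3 / 2 / (n + 1)) := by
  have h' : (n : ℝ) + 1 ≠ 0 := by positivity
  rw [sqrtCoeff_succ]
  field_simp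
  ring

lemma sqrtCoeff_succ_monotone : Monotone fun n => sqrtCoeff (n + 1) := by
  refine monotone_nat_of_le_succ fun n => ?_
  have h := sqrtCoeff_diff (n + 1)
  have h2 := sqrtCoeff_succ_neg n
  have : 0 ≤ -sqrtCoeff (n + 1) * (3 / 2 / (((n + 1 : ℕ) : ℝ) + 1)) :=
    mul_nonneg (by linarith) (by positivity)
  linarith

lemma sqrtCoeff_diff_antitone :
    Antitone fun n => sqrtCoeff (n + 2) - sqrtCoeff (n + 1) := by
  intro m n hmn
  have hm := sqrtCoeff_diff (m + 1)
  have hn := sqrtCoeff_diff (n + 1)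
  simp only [add_assoc, Nat.reduceAdd] at hm hn
  simp only [hm, hn]
  have h1 := sqrtCoeff_succ_monotone hmn
  have h2 := sqrtCoeff_succ_neg n
  have h3 := sqrtCoeff_succ_neg m
  have h4 : (m : ℝ) ≤ n := by exact_mod_cast hmn
  simp only at h1
  push_cast
  gcongr
  linarith

lemma abs_sqrtCoeff_le_one (n : ℕ) : |sqrtCoeff n| ≤ 1 := by
  cases n with
  | zero => simp [sqrtCoeff]
  | succ n =>
    rw [abs_of_neg (sqrtCoeff_succ_neg n)]
    have := sqrtCoeff_succ_monotone (Nat.zero_le n)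
    have h1 : sqrtCoeff (0 + 1) = -1 / 2 := by norm_num [sqrtCoeff]
    simp only [h1] at this
    linarith

lemma tendsto_sqrtCoeff_div :
    Tendsto (fun n : ℕ => sqrtCoeff n / (n : ℝ) ^ (-(3 : ℝ) / 2)) atTop
      (𝓝 (-1 / (2 * √π))) := by
  have hG : Real.Gamma (-1 / 2) = -2 * √π := by
    have := Real.Gamma_add_one (s := -1 / 2) (by norm_num)
    rw [show (-1 / 2 + 1 : ℝ) = 1 / 2 by norm_num, Real.Gamma_one_half_eq] at this
    linarith
  have hpi : √π ≠ 0 := by positivity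
  have h1 : Tendsto (fun n : ℕ => (Real.GammaSeq (-1 / 2) n)⁻¹) atTop
      (𝓝 (-1 / (2 * √π))) := by
    have := (Real.GammaSeq_tendsto_Gamma (-1 / 2)).inv₀ (by rw [hG]; simp [hpi])
    convert this using 2
    rw [hG]
    field_simp
  have h2 : Tendsto (fun n : ℕ => (n : ℝ) / (n - 1 / 2)) atTop (𝓝 1) := by
    have := tendsto_const_nhds (x := (1 : ℝ)) (f := atTop (α := ℕ)) |>.sub
      (tendsto_const_div_atTop_nhds_zero_nat (1 / 2 : ℝ)) |>.inv₀ (by norm_num)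
    simp only [sub_zero, inv_one] at this
    refine this.congr' ?_
    filter_upwards [eventually_ge_atTop 1] with n hn
    have : (1 : ℝ) ≤ n := by exact_mod_cast hn
    have h3 : (n : ℝ) - 1 / 2 ≠ 0 := by linarith
    field_simp
  have h3 := h1.mul h2
  rw [mul_one] at h3
  refine h3.congr' ?_
  filter_upwards [eventually_ge_atTop 1] with n hn
  have hn1 : (1 : ℝ) ≤ n := by exact_mod_cast hn
  have hn0 : (0 : ℝ) < n := by linarith
  have hs : (n : ℝ) - 1 / 2 ≠ 0 := by linarith
  have hp : (n : ℝ) ^ (-(3 : ℝ) / 2) = (n : ℝ) ^ (-1 / 2 : ℝ) / n := by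
    rw [← Real.rpow_sub_one hn0.ne']
    norm_num
  have hf : (n.factorial : ℝ) ≠ 0 := by positivity
  have hq : (n : ℝ) ^ (-1 / 2 : ℝ) ≠ 0 := by positivity
  rw [hp, Real.GammaSeq, sqrtCoeff, Finset.prod_range_succ]
  rw [show (-1 / 2 + (n : ℝ)) = n - 1 / 2 by ring]
  generalize ∏ j ∈ Finset.range n, (-1 / 2 + (j : ℝ)) = c
  generalize (n : ℝ) - 1 / 2 = d at hs ⊢
  field_simp

lemma summable_abs_sqrtCoeff : Summable fun n => |sqrtCoeff n| := by
  have hp : Summable fun n : ℕ => (n : ℝ) ^ (-(3 : ℝ) / 2) :=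
    Real.summable_nat_rpow.2 (by norm_num)
  have h1 := tendsto_sqrtCoeff_div.isBigO_one ℝ
  have h2 : (fun n : ℕ => sqrtCoeff n) =O[atTop] fun n : ℕ => (n : ℝ) ^ (-(3 : ℝ) / 2) := by
    have h3 := h1.mul (Asymptotics.isBigO_refl (fun n : ℕ => (n : ℝ) ^ (-(3 : ℝ) / 2)) atTop)
    refine (h3.congr' ?_ ?_)
    · filter_upwards [eventually_ge_atTop 1] with n hn
      have : (n : ℝ) ^ (-(3 : ℝ) / 2) ≠ 0 := by
        have : (0 : ℝ) < n := by exact_mod_cast hn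
        positivity
      field_simp
    · filter_upwards with n
      simp
  exact (summable_of_isBigO_nat hp h2).abs

lemma hasFPowerSeriesOnBall_sqrt_one_sub :
    HasFPowerSeriesOnBall (fun x : ℝ => √(1 - x)) (.ofScalars ℝ sqrtCoeff) 0 1 := by
  have h := Real.one_div_one_sub_rpow_hasFPowerSeriesOnBall_zero (-1 / 2)
  have hc : (fun n : ℕ => Ring.choose ((-1 / 2 : ℝ) + n - 1) n) = sqrtCoeff := by
    funext n
    have h1 := Ring.factorial_nsmul_multichoose_eq_ascPochhammer (-1 / 2 : ℝ) n
    rw [Ring.multichoose_eq, nsmul_eq_mul] at h1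
    rw [sqrtCoeff, eq_div_iff (by positivity), mul_comm, h1]
    rw [Polynomial.ascPochhammer_smeval_eq_eval]
    clear h1
    induction n with
    | zero => simp
    | succ n ih => rw [ascPochhammer_succ_eval, Finset.prod_range_succ, ih]
  rw [hc] at h
  refine h.congr fun x hx => ?_
  have hx1 : x < 1 := by
    rw [← ENNReal.ofReal_one, Metric.eball_ofReal, Real.ball_zero_eq_Ioo] at hx
    exact hx.2
  simp only
  rw [show (-1 / 2 : ℝ) = -(1 / 2) by norm_num, Real.rpow_neg (by linarith), Real.sqrt_eq_rpow]
  simp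

lemma hasSum_sqrtCoeff {x : ℝ} (hx : |x| ≤ 1) :
    HasSum (fun n => sqrtCoeff n * x ^ n) √(1 - x) := by
  have hb : ∀ n : ℕ, ∀ y ∈ Icc (-1 : ℝ) 1, ‖sqrtCoeff n * y ^ n‖ ≤ |sqrtCoeff n| := by
    intro n y hy
    rw [norm_mul, norm_pow, Real.norm_eq_abs, Real.norm_eq_abs]
    exact mul_le_of_le_one_right (abs_nonneg _) (pow_le_one₀ (abs_nonneg _) (abs_le.2 hy))
  have hs : Summable fun n => sqrtCoeff n * x ^ n :=
    .of_norm_bounded summable_abs_sqrtCoeff fun n => hb n x (abs_le.1 hx)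
  have hc : ContinuousOn (fun y => ∑' n, sqrtCoeff n * y ^ n) (Icc (-1 : ℝ) 1) :=
    continuousOn_tsum (fun n => by fun_prop) summable_abs_sqrtCoeff hb
  have he : EqOn (fun y => ∑' n, sqrtCoeff n * y ^ n) (fun y => √(1 - y)) (Ioo (-1 : ℝ) 1) := by
    intro y hy
    have := hasFPowerSeriesOnBall_sqrt_one_sub.hasSum (y := y) (by
      rwa [← ENNReal.ofReal_one, Metric.eball_ofReal, Real.ball_zero_eq_Ioo])
    simpa [FormalMultilinearSeries.ofScalars, mul_comm] using this.tsum_eq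
  have he' := he.of_subset_closure hc (by fun_prop) Ioo_subset_Icc_self
    (by rw [closure_Ioo (by norm_num)])
  have := he' (abs_le.1 hx)
  simp only at this
  rw [← this]
  exact hs.hasSum

/-- The Taylor series of `f` at `0` as a formal power series. -/
def taylorPS (f : ℝ → ℝ) : PowerSeries ℝ :=
  .mk fun n => iteratedDeriv n f 0 / (n.factorial : ℝ)

lemma taylorPS_congr {f g : ℝ → ℝ} (h : f =ᶠ[𝓝 0] g) : taylorPS f = taylorPS g := by
  ext n
  simp [taylorPS, h.iteratedDeriv_eq n]

lemma taylorPS_add {f g : ℝ → ℝ} (hf : AnalyticAt ℝ f 0) (hg : AnalyticAt ℝ g 0) :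
    taylorPS (f + g) = taylorPS f + taylorPS g := by
  ext n
  simp [taylorPS, iteratedDeriv_add hf.contDiffAt hg.contDiffAt, add_div]

lemma taylorPS_mul {f g : ℝ → ℝ} (hf : AnalyticAt ℝ f 0) (hg : AnalyticAt ℝ g 0) :
    taylorPS (f * g) = taylorPS f * taylorPS g := by
  ext n
  rw [PowerSeries.coeff_mul, Finset.Nat.sum_antidiagonal_eq_sum_range_succ_mk]
  simp only [taylorPS, PowerSeries.coeff_mk]
  rw [iteratedDeriv_mul hf.contDiffAt hg.contDiffAt, Finset.sum_div]
  refine Finset.sum_congr rfl fun k hk => ?_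
  have hk' : k ≤ n := Nat.lt_succ_iff.1 (Finset.mem_range.1 hk)
  rw [Nat.cast_choose ℝ hk']
  have h1 : (n.factorial : ℝ) ≠ 0 := by positivity
  field_simp

lemma taylorPS_of_hasSum {f : ℝ → ℝ} {c : ℕ → ℝ}
    (h : ∀ᶠ x in 𝓝 0, HasSum (fun n => c n * x ^ n) (f x)) :
    AnalyticAt ℝ f 0 ∧ taylorPS f = .mk c := by
  have hp : HasFPowerSeriesAt f (.ofScalars ℝ c) 0 := by
    rw [hasFPowerSeriesAt_iff]
    filter_upwards [h] with x hx
    simpa [FormalMultilinearSeries.coeff_ofScalars, mul_comm] using hx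
  refine ⟨hp.analyticAt, ?_⟩
  have := hp.analyticAt.hasFPowerSeriesAt.eq_formalMultilinearSeries hp
  ext n
  have h2 := congrArg (fun p => FormalMultilinearSeries.coeff p n) this
  simpa [FormalMultilinearSeries.coeff_ofScalars, taylorPS] using h2

lemma Polynomial.hasSum_coeff_mul_pow (p : Polynomial ℝ) (x : ℝ) :
    HasSum (fun n => p.coeff n * x ^ n) (p.eval x) := by
  rw [Polynomial.eval_eq_sum_range]
  refine hasSum_sum_of_ne_finset_zero fun n hn => ?_
  rw [Polynomial.coeff_eq_zero_of_natDegree_lt (by simpa using hn), zero_mul]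

lemma taylorPS_polynomial (p : Polynomial ℝ) :
    AnalyticAt ℝ (fun x => p.eval x) 0 ∧ taylorPS (fun x => p.eval x) = p := by
  have := taylorPS_of_hasSum (.of_forall p.hasSum_coeff_mul_pow)
  refine ⟨this.1, this.2.trans ?_⟩
  ext n
  simp

lemma hasSum_sqrtCoeff_mul_pow {b x : ℝ} (hx : |b * x| ≤ 1) :
    HasSum (fun n => sqrtCoeff n * b ^ n * x ^ n) √(1 - b * x) := by
  simpa only [mul_pow, mul_assoc] using hasSum_sqrtCoeff hx

lemma taylorPS_sqrt (b : ℝ) :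
    AnalyticAt ℝ (fun x => √(1 - b * x)) 0 ∧
      taylorPS (fun x => √(1 - b * x)) = .mk fun n => sqrtCoeff n * b ^ n := by
  refine taylorPS_of_hasSum ?_
  have h : ∀ᶠ x in 𝓝 (0 : ℝ), |b * x| < 1 :=
    ContinuousAt.eventually_lt (by fun_prop) (by fun_prop) (by simp)
  filter_upwards [h] with x hx using hasSum_sqrtCoeff_mul_pow hx.le

/-- The coefficients of `f` are asymptotic to `L * n ^ (-3/2) * b ^ n`. -/
def HasCoeffLimit (b : ℝ) (f : PowerSeries ℝ) (L : ℝ) : Prop :=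
  Tendsto (fun n : ℕ => f.coeff n / ((n : ℝ) ^ (-(3 : ℝ) / 2) * b ^ n)) atTop (𝓝 L)

/-- The coefficients of `f` are `O(ρ ^ n)`. -/
def CoeffBigO (ρ : ℝ) (f : PowerSeries ℝ) : Prop := ∃ M, ∀ n, |f.coeff n| ≤ M * ρ ^ n

/-- The geometric series `1 / (1 - η X)`. -/
def geomPS (η : ℝ) : PowerSeries ℝ := .mk fun n => η ^ n

lemma geomPS_mul_one_sub (η : ℝ) :
    (1 - PowerSeries.C η * PowerSeries.X) * geomPS η = 1 := by
  ext n
  cases n with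
  | zero => simp [geomPS, sub_mul, mul_assoc]
  | succ n =>
    simp [geomPS, sub_mul, mul_assoc, PowerSeries.coeff_succ_X_mul, pow_succ', PowerSeries.coeff_one]

lemma tendsto_shift_ratio_rpow (k : ℕ) (s : ℝ) :
    Tendsto (fun n : ℕ => (((n + k : ℕ) : ℝ) / n) ^ s) atTop (𝓝 1) := by
  have h : Tendsto (fun n : ℕ => ((n + k : ℕ) : ℝ) / n) atTop (𝓝 1) := by
    have := (tendsto_const_div_atTop_nhds_zero_nat (k : ℝ)).const_add 1
    rw [add_zero] at this
    refine this.congr' ?_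
    filter_upwards [eventually_ge_atTop 1] with n hn
    have : (n : ℝ) ≠ 0 := by positivity
    push_cast
    field_simp
  simpa using h.rpow_const (p := s) (Or.inl one_ne_zero)

lemma hasCoeffLimit_iff {b : ℝ} {f : PowerSeries ℝ} {L : ℝ} :
    HasCoeffLimit b f L ↔
      Tendsto (fun n : ℕ => f.coeff n * ((n + 1 : ℕ) : ℝ) ^ (3 / 2 : ℝ) / b ^ n) atTop (𝓝 L) := by
  have h1 := tendsto_shift_ratio_rpow 1 (3 / 2)
  have h2 := h1.inv₀ one_ne_zero
  have key : ∀ n : ℕ, 1 ≤ n → (((n + 1 : ℕ) : ℝ) / n) ^ (3 / 2 : ℝ) =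
      ((n + 1 : ℕ) : ℝ) ^ (3 / 2 : ℝ) * (n : ℝ) ^ (-(3 : ℝ) / 2) := by
    intro n _
    rw [Real.div_rpow (by positivity) (by positivity), neg_div, Real.rpow_neg (by positivity)]
    rfl
  constructor <;> intro h
  · have h3 := h.mul h1
    rw [mul_one] at h3
    refine h3.congr' ?_
    filter_upwards [eventually_ge_atTop 1] with n hn
    rw [key n hn]
    have : (n : ℝ) ^ (-(3 : ℝ) / 2) ≠ 0 := by positivity
    field_simp
  · have h3 := h.mul h2
    rw [inv_one, mul_one] at h3
    refine h3.congr' ?_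
    filter_upwards [eventually_ge_atTop 1] with n hn
    rw [key n hn]
    have : (n : ℝ) ^ (-(3 : ℝ) / 2) ≠ 0 := by positivity
    have : ((n + 1 : ℕ) : ℝ) ^ (3 / 2 : ℝ) ≠ 0 := by positivity
    field_simp

lemma HasCoeffLimit.add {b : ℝ} {f g : PowerSeries ℝ} {L M : ℝ} (hf : HasCoeffLimit b f L)
    (hg : HasCoeffLimit b g M) : HasCoeffLimit b (f + g) (L + M) := by
  simpa [HasCoeffLimit, add_div] using Tendsto.add hf hg

lemma summable_sq_mul_geometric {r : ℝ} (h0 : 0 ≤ r) (h1 : r < 1) :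
    Summable fun n : ℕ => ((n : ℝ) + 1) ^ 2 * r ^ n := by
  have hr : ‖r‖ < 1 := by rwa [Real.norm_of_nonneg h0]
  have := ((summable_pow_mul_geometric_of_norm_lt_one 2 hr).add
    ((summable_pow_mul_geometric_of_norm_lt_one 1 hr).mul_left 2)).add
    (summable_pow_mul_geometric_of_norm_lt_one 0 hr)
  refine this.congr fun n => ?_
  ring

lemma rpow_three_halves_le_sq {n : ℕ} :
    ((n + 1 : ℕ) : ℝ) ^ (3 / 2 : ℝ) ≤ ((n : ℝ) + 1) ^ 2 := by
  have h : (1 : ℝ) ≤ ((n + 1 : ℕ) : ℝ) := by simp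
  have := Real.rpow_le_rpow_of_exponent_le h (show (3 / 2 : ℝ) ≤ (2 : ℕ) by norm_num)
  rw [Real.rpow_natCast] at this
  simpa using this

lemma CoeffBigO.hasCoeffLimit_zero {ρ b : ℝ} {f : PowerSeries ℝ} (h0 : 0 ≤ ρ) (hb : ρ < b)
    (hf : CoeffBigO ρ f) : HasCoeffLimit b f 0 := by
  obtain ⟨M, hM⟩ := hf
  have hb0 : 0 < b := h0.trans_lt hb
  rw [hasCoeffLimit_iff]
  have hs := (summable_sq_mul_geometric (r := ρ / b) (by positivity)
    ((div_lt_one hb0).2 hb)).tendsto_atTop_zero.const_mul M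
  rw [mul_zero] at hs
  refine squeeze_zero_norm (fun n => ?_) hs
  rw [norm_div, norm_mul, Real.norm_eq_abs, Real.norm_of_nonneg (by positivity),
    Real.norm_of_nonneg (by positivity), div_pow]
  calc |f.coeff n| * ((n + 1 : ℕ) : ℝ) ^ (3 / 2 : ℝ) / b ^ n
      ≤ (M * ρ ^ n) * ((n : ℝ) + 1) ^ 2 / b ^ n := by
        gcongr
        · exact (abs_nonneg _).trans (hM n)
        · exact hM n
        · exact rpow_three_halves_le_sq
    _ = _ := by ring

/-- Convolution with a series of larger radius of convergence multiplies the coefficient limit by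
the value of that series at `b⁻¹`. -/
lemma HasCoeffLimit.mul {ρ b L V : ℝ} {f v : PowerSeries ℝ} (hf : HasCoeffLimit b f L)
    (h0 : 0 ≤ ρ) (hb : ρ < b) (hv : CoeffBigO ρ v)
    (hV : HasSum (fun n => v.coeff n * b⁻¹ ^ n) V) : HasCoeffLimit b (v * f) (V * L) := by
  obtain ⟨M, hM⟩ := hv
  have hb0 : 0 < b := h0.trans_lt hb
  rw [hasCoeffLimit_iff] at hf ⊢
  obtain ⟨U, hU⟩ := hf.abs.bddAbove_range
  replace hU : ∀ n : ℕ, |f.coeff n * ((n + 1 : ℕ) : ℝ) ^ (3 / 2 : ℝ) / b ^ n| ≤ U :=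
    fun n => hU ⟨n, rfl⟩
  have hU0 : 0 ≤ U := (abs_nonneg _).trans (hU 0)
  let F : ℕ → ℕ → ℝ := fun n k => if k ≤ n then
    v.coeff k * f.coeff (n - k) * ((n + 1 : ℕ) : ℝ) ^ (3 / 2 : ℝ) / b ^ n else 0
  have hF : ∀ n, ∑' k, F n k =
      (v * f).coeff n * ((n + 1 : ℕ) : ℝ) ^ (3 / 2 : ℝ) / b ^ n := by
    intro n
    rw [tsum_eq_sum (s := Finset.range (n + 1))
      (fun k hk => if_neg (by simpa [Nat.lt_succ_iff] using hk)), PowerSeries.coeff_mul,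
      Finset.Nat.sum_antidiagonal_eq_sum_range_succ_mk, Finset.sum_mul, Finset.sum_div]
    exact Finset.sum_congr rfl fun k hk => if_pos (Nat.lt_succ_iff.1 (Finset.mem_range.1 hk))
  have hsplit : ∀ m k : ℕ, F (m + k) k = v.coeff k * b⁻¹ ^ k *
      (f.coeff m * ((m + 1 : ℕ) : ℝ) ^ (3 / 2 : ℝ) / b ^ m) *
      (((m + 1 + k : ℕ) : ℝ) / ((m + 1 : ℕ) : ℝ)) ^ (3 / 2 : ℝ) := by
    intro m k
    have h1 : ((m + 1 : ℕ) : ℝ) ^ (3 / 2 : ℝ) ≠ 0 := by positivity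
    simp only [F, if_pos (Nat.le_add_left k m), Nat.add_sub_cancel]
    rw [Real.div_rpow (by positivity) (by positivity), show m + k + 1 = m + 1 + k by ring, pow_add,
      inv_pow]
    field_simp
  rw [← hV.mul_right L |>.tsum_eq]
  simp only [← hF]
  refine tendsto_tsum_of_dominated_convergence
    (bound := fun k : ℕ => M * U * (((k : ℝ) + 1) ^ 2 * (ρ / b) ^ k))
    ((summable_sq_mul_geometric (by positivity) ((div_lt_one hb0).2 hb)).mul_left _) ?_ ?_
  · intro k
    rw [← tendsto_add_atTop_iff_nat k]
    simp only [hsplit]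
    have h1 := (tendsto_shift_ratio_rpow k (3 / 2)).comp (tendsto_add_atTop_nat 1)
    simpa using (hf.const_mul (v.coeff k * b⁻¹ ^ k)).mul h1
  · refine .of_forall fun n k => ?_
    have hM0 : 0 ≤ M := by simpa using (abs_nonneg _).trans (hM 0)
    by_cases hk : k ≤ n
    · obtain ⟨m, rfl⟩ := Nat.exists_eq_add_of_le' hk
      rw [hsplit, norm_mul, norm_mul, norm_mul, Real.norm_eq_abs, Real.norm_eq_abs (_ / _),
        Real.norm_of_nonneg (by positivity), Real.norm_of_nonneg (by positivity)]
      have hr : (((m + 1 + k : ℕ) : ℝ) / ((m + 1 : ℕ) : ℝ)) ^ (3 / 2 : ℝ) ≤ ((k : ℝ) + 1) ^ 2 := by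
        refine le_trans (Real.rpow_le_rpow (by positivity) ?_ (by norm_num))
          rpow_three_halves_le_sq
        rw [div_le_iff₀ (by positivity)]
        push_cast
        nlinarith [Nat.cast_nonneg (α := ℝ) m, Nat.cast_nonneg (α := ℝ) k,
          mul_nonneg (Nat.cast_nonneg (α := ℝ) m) (Nat.cast_nonneg (α := ℝ) k)]
      calc _ ≤ (M * ρ ^ k) * b⁻¹ ^ k * U * ((k : ℝ) + 1) ^ 2 := by
            gcongr
            · exact hM k
            · exact hU m
        _ = _ := by rw [div_eq_mul_inv, mul_pow]; ring
    · simp only [F, if_neg hk, norm_zero]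
      positivity

lemma CoeffBigO.add {ρ : ℝ} {f g : PowerSeries ℝ} (hf : CoeffBigO ρ f) (hg : CoeffBigO ρ g) :
    CoeffBigO ρ (f + g) := by
  obtain ⟨M, hM⟩ := hf
  obtain ⟨M', hM'⟩ := hg
  refine ⟨M + M', fun n => ?_⟩
  rw [map_add, add_mul]
  exact (abs_add_le _ _).trans (add_le_add (hM n) (hM' n))

lemma CoeffBigO.C_mul {ρ : ℝ} {f : PowerSeries ℝ} (hf : CoeffBigO ρ f) (c : ℝ) :
    CoeffBigO ρ (PowerSeries.C c * f) := by
  obtain ⟨M, hM⟩ := hf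
  refine ⟨|c| * M, fun n => ?_⟩
  rw [PowerSeries.coeff_C_mul, abs_mul, mul_assoc]
  exact mul_le_mul_of_nonneg_left (hM n) (abs_nonneg _)

lemma coeffBigO_geomPS (η : ℝ) : CoeffBigO |η| (geomPS η) :=
  ⟨1, fun n => by simp [geomPS]⟩

lemma coeffBigO_sqrt {b : ℝ} (hb : 0 ≤ b) :
    CoeffBigO b (.mk fun n => sqrtCoeff n * b ^ n) := by
  refine ⟨1, fun n => ?_⟩
  rw [PowerSeries.coeff_mk, abs_mul, abs_of_nonneg (pow_nonneg hb n)]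
  exact mul_le_mul_of_nonneg_right (abs_sqrtCoeff_le_one n) (by positivity)

lemma coeffBigO_polynomial {ρ : ℝ} (hρ : 0 < ρ) (p : Polynomial ℝ) :
    CoeffBigO ρ (p : PowerSeries ℝ) := by
  refine ⟨∑ k ∈ p.support, |p.coeff k| / ρ ^ k, fun n => ?_⟩
  rw [Polynomial.coeff_coe, ← div_le_iff₀ (by positivity)]
  by_cases hn : n ∈ p.support
  · exact Finset.single_le_sum (f := fun k => |p.coeff k| / ρ ^ k)
      (fun k _ => by positivity) hn
  · rw [Polynomial.notMem_support_iff.1 hn, abs_zero, zero_div]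
    exact Finset.sum_nonneg fun k _ => by positivity

lemma hasSum_coeff_mul_geomPS {η : ℝ} (hη : η ≠ 0) {f : PowerSeries ℝ}
    (hf : HasSum (fun n => f.coeff n * η⁻¹ ^ n) 0) (n : ℕ) :
    HasSum (fun j => f.coeff (n + 1 + j) * η⁻¹ ^ (j + 1)) (-(f * geomPS η).coeff n) := by
  have h := ((hasSum_nat_add_iff' (n + 1)).2 hf).mul_left (η ^ n)
  have h1 : (fun j => f.coeff (n + 1 + j) * η⁻¹ ^ (j + 1)) =
      fun j => η ^ n * (f.coeff (j + (n + 1)) * η⁻¹ ^ (j + (n + 1))) := by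
    funext j
    rw [show n + 1 + j = j + (n + 1) by ring, show j + (n + 1) = n + (j + 1) by ring,
      pow_add _ n (j + 1), inv_pow _ n]
    field_simp
  have h2 : -(f * geomPS η).coeff n =
      η ^ n * (0 - ∑ k ∈ Finset.range (n + 1), f.coeff k * η⁻¹ ^ k) := by
    rw [zero_sub, mul_neg, PowerSeries.coeff_mul,
      Finset.Nat.sum_antidiagonal_eq_sum_range_succ_mk, Finset.mul_sum]
    congr 1
    refine Finset.sum_congr rfl fun k hk => ?_
    have hk' : k ≤ n := Nat.lt_succ_iff.1 (Finset.mem_range.1 hk)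
    simp only [geomPS, PowerSeries.coeff_mk]
    rw [pow_sub₀ _ hη hk', inv_pow]
    ring
  rw [h1, h2]
  exact h

/-- Dividing by `1 - η X` does not enlarge the coefficients if the series vanishes at `η⁻¹`. -/
lemma CoeffBigO.mul_geomPS {ρ η : ℝ} {f : PowerSeries ℝ} (h0 : 0 ≤ ρ) (hη : ρ < |η|)
    (hf : CoeffBigO ρ f) (hs : HasSum (fun n => f.coeff n * η⁻¹ ^ n) 0) :
    CoeffBigO ρ (f * geomPS η) := by
  obtain ⟨M, hM⟩ := hf
  have hη0 : 0 < |η| := h0.trans_lt hη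
  have hη1 : η ≠ 0 := abs_pos.1 hη0
  have hr : ρ / |η| < 1 := (div_lt_one hη0).2 hη
  refine ⟨M * (ρ / |η|) * (1 - ρ / |η|)⁻¹, fun n => ?_⟩
  have hg := (hasSum_geometric_of_lt_one (by positivity) hr).mul_left (M * ρ ^ n * (ρ / |η|))
  have h1 := hasSum_coeff_mul_geomPS hη1 hs n
  have h2 := tsum_of_norm_bounded hg (f := fun j => f.coeff (n + 1 + j) * η⁻¹ ^ (j + 1))
    (fun j => by
      rw [norm_mul, norm_pow, norm_inv, Real.norm_eq_abs, Real.norm_eq_abs]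
      calc _ ≤ (M * ρ ^ (n + 1 + j)) * |η|⁻¹ ^ (j + 1) := by
            gcongr
            exact hM _
        _ = _ := by rw [div_eq_mul_inv]; ring)
  rw [h1.tsum_eq, norm_neg, Real.norm_eq_abs] at h2
  exact h2.trans_eq (by ring)

lemma summable_mul_pow_of_abs_le_one {p : ℕ → ℝ} (hp : Summable fun n => |p n|) {θ : ℝ}
    (hθ : |θ| ≤ 1) : Summable fun n => p n * θ ^ n := by
  refine .of_norm_bounded hp fun n => ?_
  rw [norm_mul, norm_pow, Real.norm_eq_abs, Real.norm_eq_abs]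
  exact mul_le_of_le_one_right (abs_nonneg _) (pow_le_one₀ (abs_nonneg _) hθ)

/-- Summation by parts for a power series on the closed unit interval. -/
lemma one_sub_mul_tsum_mul_pow {p : ℕ → ℝ} (hp : Summable fun n => |p n|) {θ : ℝ}
    (hθ : |θ| ≤ 1) :
    (1 - θ) * ∑' n, p n * θ ^ n = p 0 + θ * ∑' n, (p (n + 1) - p n) * θ ^ n := by
  have h0 := summable_mul_pow_of_abs_le_one hp hθ
  have h1 := summable_mul_pow_of_abs_le_one ((summable_nat_add_iff 1).2 hp) hθ
  have h2 := h0.tsum_eq_zero_add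
  have h3 : ∑' n, p (n + 1) * θ ^ (n + 1) = θ * ∑' n, p (n + 1) * θ ^ n := by
    rw [← tsum_mul_left]
    exact tsum_congr fun n => by ring
  simp only [sub_mul, h1.tsum_sub h0]
  rw [h3] at h2
  linear_combination h2

lemma abs_one_sub_mul_tsum_le {p : ℕ → ℝ} (hp : Summable p) (hanti : Antitone p)
    (h0 : ∀ n, 0 ≤ p n) {θ : ℝ} (hθ : |θ| ≤ 1) :
    |(1 - θ) * ∑' n, p n * θ ^ n| ≤ 2 * p 0 := by
  rw [one_sub_mul_tsum_mul_pow (by simpa only [abs_of_nonneg (h0 _)] using hp) hθ]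
  have hp1 : Summable fun n => p (n + 1) := (summable_nat_add_iff 1).2 hp
  have ht : HasSum (fun n => p n - p (n + 1)) (p 0) := by
    have := hp.hasSum.sub hp1.hasSum
    rwa [hp.tsum_eq_zero_add, add_sub_cancel_right] at this
  have hb := tsum_of_norm_bounded ht (f := fun n => (p (n + 1) - p n) * θ ^ n) fun n => by
    rw [norm_mul, norm_pow, Real.norm_eq_abs, Real.norm_eq_abs, abs_sub_comm,
      abs_of_nonneg (sub_nonneg.2 (hanti n.le_succ))]
    exact mul_le_of_le_one_right (sub_nonneg.2 (hanti n.le_succ))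
      (pow_le_one₀ (abs_nonneg _) hθ)
  rw [Real.norm_eq_abs] at hb
  calc |p 0 + θ * ∑' n, (p (n + 1) - p n) * θ ^ n|
      ≤ |p 0| + |θ| * |∑' n, (p (n + 1) - p n) * θ ^ n| := by
        rw [← abs_mul]
        exact abs_add_le _ _
    _ ≤ p 0 + 1 * p 0 := by
        rw [abs_of_nonneg (h0 0)]
        gcongr
    _ = 2 * p 0 := by ring

lemma tendsto_sqrtCoeff_add_div (k : ℕ) :
    Tendsto (fun n : ℕ => sqrtCoeff (n + k) / (n : ℝ) ^ (-(3 : ℝ) / 2)) atTop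
      (𝓝 (-1 / (2 * √π))) := by
  have h1 := (tendsto_add_atTop_iff_nat k).2 tendsto_sqrtCoeff_div
  have h2 := h1.mul (tendsto_shift_ratio_rpow k (-(3 : ℝ) / 2))
  rw [mul_one] at h2
  refine h2.congr' ?_
  filter_upwards [eventually_ge_atTop 1] with n hn
  have hn0 : (0 : ℝ) < n := by exact_mod_cast hn
  have hk0 : (0 : ℝ) < ((n + k : ℕ) : ℝ) := by exact_mod_cast (by omega : 0 < n + k)
  rw [Real.div_rpow hk0.le hn0.le]
  have : ((n + k : ℕ) : ℝ) ^ (-(3 : ℝ) / 2) ≠ 0 := by positivity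
  field_simp

lemma tendsto_tsum_sqrtCoeff_div {θ : ℝ} (hθ : |θ| ≤ 1) (hθ1 : θ ≠ 1) :
    Tendsto (fun n : ℕ => (∑' j, sqrtCoeff (n + 1 + j) * θ ^ j) / (n : ℝ) ^ (-(3 : ℝ) / 2)) atTop
      (𝓝 (-1 / (2 * √π) / (1 - θ))) := by
  have hθ2 : 0 < 1 - θ := sub_pos.2 (lt_of_le_of_ne (abs_le.1 hθ).2 hθ1)
  let D : ℕ → ℝ := fun n => ∑' j, (sqrtCoeff (n + 1 + (j + 1)) - sqrtCoeff (n + 1 + j)) * θ ^ j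
  have hsum : ∀ k, Summable fun j => |sqrtCoeff (k + j)| := fun k => by
    simpa only [add_comm k] using (summable_nat_add_iff k).2 summable_abs_sqrtCoeff
  have hD : ∀ n, |(1 - θ) * D n| ≤ 2 * (sqrtCoeff (n + 2) - sqrtCoeff (n + 1)) := fun n => by
    refine abs_one_sub_mul_tsum_le
      (p := fun j => sqrtCoeff (n + 1 + (j + 1)) - sqrtCoeff (n + 1 + j)) ?_ ?_ ?_ hθ
    · have h1 := (hsum (n + 2)).of_abs.sub (hsum (n + 1)).of_abs
      refine h1.congr fun j => ?_
      rw [show n + 1 + (j + 1) = n + 2 + j by ring]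
    · intro i j hij
      have := sqrtCoeff_diff_antitone (add_le_add_right hij n)
      simpa only [show ∀ i, n + i + 2 = n + 1 + (i + 1) from fun i => by ring,
        show ∀ i, n + i + 1 = n + 1 + i from fun i => by ring] using this
    · intro j
      have h : sqrtCoeff (n + j + 1) ≤ sqrtCoeff (n + j + 1 + 1) :=
        sqrtCoeff_succ_monotone (Nat.le_succ (n + j))
      rw [show n + j + 1 + 1 = n + 1 + (j + 1) by ring, show n + j + 1 = n + 1 + j by ring] at h
      exact sub_nonneg.2 h
  have hdlim : Tendsto (fun n : ℕ => 2 * (sqrtCoeff (n + 2) / (n : ℝ) ^ (-(3 : ℝ) / 2) -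
      sqrtCoeff (n + 1) / (n : ℝ) ^ (-(3 : ℝ) / 2)) / (1 - θ)) atTop (𝓝 0) := by
    simpa using (((tendsto_sqrtCoeff_add_div 2).sub
      (tendsto_sqrtCoeff_add_div 1)).const_mul 2).div_const (1 - θ)
  have hDlim : Tendsto (fun n : ℕ => D n / (n : ℝ) ^ (-(3 : ℝ) / 2)) atTop (𝓝 0) := by
    refine squeeze_zero_norm (fun n => ?_) hdlim
    have h := hD n
    rw [abs_mul, abs_of_pos hθ2] at h
    rw [Real.norm_eq_abs, abs_div, abs_of_nonneg (a := (n : ℝ) ^ (-(3 : ℝ) / 2)) (by positivity),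
      ← sub_div, le_div_iff₀ hθ2, mul_comm, ← mul_div_assoc, ← mul_div_assoc]
    gcongr
  have hlim := ((tendsto_sqrtCoeff_add_div 1).add (hDlim.const_mul θ)).div_const (1 - θ)
  rw [mul_zero, add_zero] at hlim
  refine hlim.congr fun n => ?_
  have h := one_sub_mul_tsum_mul_pow (hsum (n + 1)) hθ
  rw [add_zero] at h
  rw [← mul_div_assoc, ← add_div, ← h]
  field_simp

/-- Coefficient asymptotics of `(√(1 - b x) - √(1 - b / η)) / (1 - η x)`, whose singularity at
`1 / η` is removable, for `1 / η` in the closed disc of radius `1 / b`. -/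
lemma hasCoeffLimit_sqrt_sub_mul_geomPS {b η : ℝ} (hb : 0 < b) (hη : b ≤ |η|) (hηb : η ≠ b) :
    HasCoeffLimit b
      ((.mk (fun n => sqrtCoeff n * b ^ n) - PowerSeries.C √(1 - b * η⁻¹)) * geomPS η)
      ((1 - η * b⁻¹)⁻¹ * (-1 / (2 * √π))) := by
  have hη0 : η ≠ 0 := abs_pos.1 (hb.trans_le hη)
  set θ := b * η⁻¹ with hθdef
  have hθ : |θ| ≤ 1 := by
    rw [hθdef, abs_mul, abs_inv, abs_of_pos hb, ← div_eq_mul_inv]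
    exact (div_le_one (hb.trans_le hη)).2 hη
  have hθ1 : θ ≠ 1 := fun h => hηb (by rw [hθdef] at h; field_simp at h; exact h.symm)
  have hs : HasSum (fun n => PowerSeries.coeff n
      (.mk (fun n => sqrtCoeff n * b ^ n) - PowerSeries.C √(1 - θ)) * η⁻¹ ^ n) 0 := by
    have h1 := hasSum_sqrtCoeff_mul_pow hθ
    have h2 := (Polynomial.C √(1 - θ)).hasSum_coeff_mul_pow η⁻¹
    have h3 := h1.sub h2
    rw [Polynomial.eval_C, sub_self] at h3
    refine h3.congr_fun fun n => ?_
    rw [map_sub, PowerSeries.coeff_mk, sub_mul, ← Polynomial.coe_C, Polynomial.coeff_coe]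
  have hcoeff : ∀ n, PowerSeries.coeff n
      ((.mk (fun n => sqrtCoeff n * b ^ n) - PowerSeries.C √(1 - θ)) * geomPS η) =
      -(b ^ n * θ * ∑' j, sqrtCoeff (n + 1 + j) * θ ^ j) := by
    intro n
    rw [eq_neg_iff_add_eq_zero, ← neg_eq_iff_add_eq_zero,
      ← (hasSum_coeff_mul_geomPS hη0 hs n).tsum_eq, ← tsum_mul_left]
    refine tsum_congr fun j => ?_
    rw [map_sub, PowerSeries.coeff_mk, PowerSeries.coeff_C, if_neg (by omega), hθdef, mul_pow]
    ring
  have h := (tendsto_tsum_sqrtCoeff_div hθ hθ1).const_mul (-θ)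
  have hθ2 : 1 - θ ≠ 0 := sub_ne_zero.2 hθ1.symm
  have hval : (1 - η * b⁻¹)⁻¹ * (-1 / (2 * √π)) = -θ * (-1 / (2 * √π) / (1 - θ)) := by
    have h1 : 1 - η * b⁻¹ = -(1 - θ) / θ := by
      rw [hθdef]
      field_simp
      ring
    rw [h1]
    field_simp
  rw [HasCoeffLimit, hval]
  refine h.congr fun n => ?_
  rw [hcoeff]
  have : b ^ n ≠ 0 := by positivity
  field_simp

lemma b2v_pos {l1 l2 m1 : ℝ} (hl2 : 0 < l2) : 0 < b2v l1 l2 m1 := by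
  unfold b2v
  positivity

lemma b2v_lt_b1v {l1 l2 m1 : ℝ} (hl1 : 0 < l1) (hl2 : 0 < l2) (hm1 : 0 < m1) :
    b2v l1 l2 m1 < b1v l1 l2 m1 := by
  unfold b1v b2v
  have h := mul_pos (Real.sqrt_pos.2 hl1) (Real.sqrt_pos.2 hm1)
  refine div_lt_div_of_pos_left hl2 (by positivity) ?_
  nlinarith

lemma Delta_eq_mul {l1 l2 m1 : ℝ} (hl1 : 0 < l1) (hl2 : 0 < l2) (hm1 : 0 < m1) (y : ℝ) :
    Delta l1 l2 m1 y = (l2 / √(b1v l1 l2 m1 * b2v l1 l2 m1)) ^ 2 *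
      ((1 - b1v l1 l2 m1 * y) * (1 - b2v l1 l2 m1 * y)) := by
  have h1 := b1v_pos (l1 := l1) (m1 := m1) hl2
  have h2 := b2v_pos (l1 := l1) (m1 := m1) hl2
  rw [div_pow, Real.sq_sqrt (by positivity)]
  have e1 : l2 / b1v l1 l2 m1 * (1 - b1v l1 l2 m1 * y) = l2 - l2 * y + (√m1 - √l1) ^ 2 := by
    unfold b1v
    have : l2 + (√m1 - √l1) ^ 2 ≠ 0 := by positivity
    field_simp
    ring
  have e2 : l2 / b2v l1 l2 m1 * (1 - b2v l1 l2 m1 * y) = l2 - l2 * y + (√m1 + √l1) ^ 2 := by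
    unfold b2v
    have : l2 + (√m1 + √l1) ^ 2 ≠ 0 := by positivity
    field_simp
    ring
  have s1 := Real.sq_sqrt hl1.le
  have s2 := Real.sq_sqrt hm1.le
  calc Delta l1 l2 m1 y
      = (l2 - l2 * y + (√m1 - √l1) ^ 2) * (l2 - l2 * y + (√m1 + √l1) ^ 2) := by
        unfold Delta
        generalize √l1 = a at s1
        generalize √m1 = c at s2
        subst s1 s2
        ring
    _ = _ := by
        rw [← e1, ← e2]
        ring

lemma sqrt_Delta {l1 l2 m1 : ℝ} (hl1 : 0 < l1) (hl2 : 0 < l2) (hm1 : 0 < m1) {y : ℝ}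
    (hy : 0 ≤ 1 - b1v l1 l2 m1 * y) :
    √(Delta l1 l2 m1 y) = l2 / √(b1v l1 l2 m1 * b2v l1 l2 m1) *
      √(1 - b2v l1 l2 m1 * y) * √(1 - b1v l1 l2 m1 * y) := by
  rw [Delta_eq_mul hl1 hl2 hm1, Real.sqrt_mul (sq_nonneg _), Real.sqrt_sq (by positivity),
    Real.sqrt_mul hy]
  ring

lemma one_sub_b2v_mul_nonneg {l1 l2 m1 : ℝ} (hl1 : 0 < l1) (hl2 : 0 < l2) (hm1 : 0 < m1) {y : ℝ}
    (hy : 0 ≤ 1 - b1v l1 l2 m1 * y) : 0 ≤ 1 - b2v l1 l2 m1 * y := by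
  have h := b2v_lt_b1v hl1 hl2 hm1
  have h2 := b2v_pos (l1 := l1) (m1 := m1) hl2
  rcases le_total y 0 with h0 | h0 <;> nlinarith

lemma Delta_nonneg {l1 l2 m1 : ℝ} (hl1 : 0 < l1) (hl2 : 0 < l2) (hm1 : 0 < m1) {y : ℝ}
    (hy : 0 ≤ 1 - b1v l1 l2 m1 * y) : 0 ≤ Delta l1 l2 m1 y := by
  rw [Delta_eq_mul hl1 hl2 hm1]
  exact mul_nonneg (sq_nonneg _) (mul_nonneg hy (one_sub_b2v_mul_nonneg hl1 hl2 hm1 hy))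

/-- The polynomial part of `T* ι`. -/
def linPart (l1 l2 m1 m2 : ℝ) : Polynomial ℝ :=
  Polynomial.C (2 * m1 * l2 / m2 - l2) * Polynomial.X + Polynomial.C (l1 + l2 - m1)

lemma Tstar_mul_iotaf {l1 l2 m1 m2 : ℝ} (hm2 : 0 < m2) (hsum : l1 + l2 + m1 + m2 = 1) {y : ℝ}
    (hy : y ≠ 1) (hD : 0 ≤ Delta l1 l2 m1 y) :
    Tstar l1 l2 m1 m2 y * iotaf l1 l2 m1 m2 y =
      (linPart l1 l2 m1 m2).eval y + √(Delta l1 l2 m1 y) := by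
  have hs := Real.sq_sqrt hD
  have hy' : y - 1 ≠ 0 := sub_ne_zero.2 hy
  obtain rfl : m2 = 1 - l1 - l2 - m1 := by linarith
  unfold Tstar iotaf linPart Ff
  generalize √(Delta l1 l2 m1 y) = S at hs
  unfold Delta at hs
  simp only [Polynomial.eval_add, Polynomial.eval_mul, Polynomial.eval_C, Polynomial.eval_X]
  have := hm2.ne'
  field_simp
  linear_combination (-y) * hs

lemma Tstar_one_ne_zero {l1 l2 m1 m2 : ℝ} (hsum : l1 + l2 + m1 + m2 = 1) (h : l1 < m1) :
    Tstar l1 l2 m1 m2 1 ≠ 0 := by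
  have h1 : Delta l1 l2 m1 1 = (m1 - l1) ^ 2 := by
    unfold Delta
    ring
  rw [Tstar, Ff, h1, Real.sqrt_sq (by linarith)]
  intro h0
  linarith

/-- `β` as a polynomial. -/
def betaPoly (l1 l2 : ℝ) (N : ℕ) : Polynomial ℝ :=
  Polynomial.C (∑ k ∈ Finset.range N, (l2 / (l1 + l2) * 1) ^ k)⁻¹ *
    ∑ k ∈ Finset.range N, (Polynomial.C (l2 / (l1 + l2)) * Polynomial.X) ^ k

lemma eval_betaPoly (l1 l2 : ℝ) (N : ℕ) (y : ℝ) :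
    (betaPoly l1 l2 N).eval y = betaf l1 l2 N y := by
  simp [betaPoly, betaf, Polynomial.eval_finsetSum, div_eq_inv_mul]

/-- The Taylor series of `√(1 - b x)`. -/
def sqrtPS (b : ℝ) : PowerSeries ℝ := .mk fun n => sqrtCoeff n * b ^ n

lemma hasCoeffLimit_sqrtPS {b : ℝ} (hb : 0 < b) :
    HasCoeffLimit b (sqrtPS b) (-1 / (2 * √π)) := by
  refine tendsto_sqrtCoeff_div.congr fun n => ?_
  have : b ^ n ≠ 0 := by positivity
  rw [sqrtPS, PowerSeries.coeff_mk, mul_div_mul_right _ _ this]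

lemma hasSum_coeff_C_mul_sqrtPS (c : ℝ) {b x : ℝ} (h : |b * x| ≤ 1) :
    HasSum (fun n => (PowerSeries.C c * sqrtPS b).coeff n * x ^ n) (c * √(1 - b * x)) := by
  simpa only [PowerSeries.coeff_C_mul, sqrtPS, PowerSeries.coeff_mk, mul_assoc] using
    (hasSum_sqrtCoeff_mul_pow h).mul_left c

/-- The coefficient limit of `(q + c √(1 - b' x) √(1 - b x)) B / (1 - η x)` when `1 / η` is outside
the closed disc of convergence, or the numerator vanishes there. -/
lemma hasCoeffLimit_of_sqrt_mul_sqrt {b b' c η : ℝ} (q B : Polynomial ℝ) (hb' : 0 < b')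
    (hb : b' < b) (hη : |η| < b ∨ b ≤ |η| ∧ η ≠ b ∧
      q.eval η⁻¹ + c * √(1 - b' * η⁻¹) * √(1 - b * η⁻¹) = 0) :
    HasCoeffLimit b
      ((q + PowerSeries.C c * sqrtPS b' * sqrtPS b) * B * geomPS η)
      ((1 - η * b⁻¹)⁻¹ * (B.eval b⁻¹ * (c * √(1 - b' * b⁻¹) * (-1 / (2 * √π))))) := by
  have hb0 : 0 < b := hb'.trans hb
  have hS : CoeffBigO b' (PowerSeries.C c * sqrtPS b') := (coeffBigO_sqrt hb'.le).C_mul c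
  have hSsum : HasSum (fun n => (PowerSeries.C c * sqrtPS b').coeff n * b⁻¹ ^ n)
      (c * √(1 - b' * b⁻¹)) := by
    refine hasSum_coeff_C_mul_sqrtPS c ?_
    rw [abs_of_nonneg (by positivity), ← div_eq_mul_inv]
    exact (div_le_one hb0).2 hb.le
  have hB := coeffBigO_polynomial hb' B
  have hBsum : HasSum (fun n => (B : PowerSeries ℝ).coeff n * b⁻¹ ^ n) (B.eval b⁻¹) := by
    simpa only [Polynomial.coeff_coe] using B.hasSum_coeff_mul_pow b⁻¹
  rcases hη with hη | ⟨hη, hηb, hz⟩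
  · have hG := coeffBigO_geomPS η
    have hGsum : HasSum (fun n => (geomPS η).coeff n * b⁻¹ ^ n) (1 - η * b⁻¹)⁻¹ := by
      simp only [geomPS, PowerSeries.coeff_mk, ← mul_pow]
      refine hasSum_geometric_of_abs_lt_one ?_
      rw [abs_mul, abs_inv, abs_of_pos hb0, ← div_eq_mul_inv]
      exact (div_lt_one hb0).2 hη
    have h1 := (((coeffBigO_polynomial hb' q).hasCoeffLimit_zero hb'.le hb).mul
      hb'.le hb hB hBsum).mul (abs_nonneg η) hη hG hGsum
    have h2 := (((hasCoeffLimit_sqrtPS hb0).mul hb'.le hb hS hSsum).mul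
      hb'.le hb hB hBsum).mul (abs_nonneg η) hη hG hGsum
    convert h1.add h2 using 1 <;> ring
  · have hη0 : 0 < |η| := hb0.trans_le hη
    set s := √(1 - b * η⁻¹) with hs
    have h1 : CoeffBigO b' (q + PowerSeries.C s * (PowerSeries.C c * sqrtPS b')) :=
      (coeffBigO_polynomial hb' q).add (hS.C_mul s)
    have h1s : HasSum (fun n =>
        (q + PowerSeries.C s * (PowerSeries.C c * sqrtPS b')).coeff n * η⁻¹ ^ n) 0 := by
      have h3 := hasSum_coeff_C_mul_sqrtPS c (b := b') (x := η⁻¹) (by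
        rw [abs_mul, abs_inv, abs_of_pos hb', ← div_eq_mul_inv]
        exact (div_le_one hη0).2 (hb.le.trans hη))
      have h4 := (q.hasSum_coeff_mul_pow η⁻¹).add (h3.mul_left s)
      rw [show q.eval η⁻¹ + s * (c * √(1 - b' * η⁻¹)) = 0 by linear_combination hz] at h4
      refine h4.congr_fun fun n => ?_
      rw [map_add, Polynomial.coeff_coe, PowerSeries.coeff_C_mul, add_mul, mul_assoc]
    have h5 := ((h1.mul_geomPS hb'.le (hb.trans_le hη) h1s).hasCoeffLimit_zero hb'.le hb).mul
      hb'.le hb hB hBsum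
    have h6 := ((hasCoeffLimit_sqrt_sub_mul_geomPS hb0 hη hηb).mul hb'.le hb hS hSsum).mul
      hb'.le hb hB hBsum
    rw [← hs, ← sqrtPS] at h6
    convert h5.add h6 using 1 <;> ring

/-- Proposition 9: coefficient asymptotics `g_n ∼ b1·β(1/b1)·σ(η)·n^{−3/2}·b1^n`
for `g(y) = T*(y)·ι(y)·β(y)/(1−η·y)`. -/
theorem stmt16 (l1 l2 m1 m2 : ℝ) (hl1 : 0 < l1) (hl2 : 0 < l2) (hm1 : 0 < m1) (hm2 : 0 < m2)
    (hsum : l1 + l2 + m1 + m2 = 1) (hr : l1 / m1 + l2 / m2 < 1)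
    (N : ℕ) (hN : 1 ≤ N)
    (η : ℝ) (hmem : η = eta1 l2 m1 m2 ∨ η = eta2 l2 m1 m2)
    (hη0 : η ≠ 0) (hηb : η ≠ b1v l1 l2 m1)
    (hηc : |η| < b1v l1 l2 m1 ∨ Tstar l1 l2 m1 m2 (1 / η) = 0) :
    AnalyticAt ℝ
      (fun y => Tstar l1 l2 m1 m2 y * iotaf l1 l2 m1 m2 y * betaf l1 l2 N y
        / (1 - η * y)) 0 ∧
    Tendsto
      (fun n : ℕ =>
        (iteratedDeriv n
            (fun y => Tstar l1 l2 m1 m2 y * iotaf l1 l2 m1 m2 y * betaf l1 l2 N y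
              / (1 - η * y)) 0 / (Nat.factorial n : ℝ))
          / ((n : ℝ) ^ (-(3:ℝ) / 2) * b1v l1 l2 m1 ^ n))
      atTop
      (𝓝 (b1v l1 l2 m1 * betaf l1 l2 N (1 / b1v l1 l2 m1) * sigmav l1 l2 m1 η)) := by
  set b := b1v l1 l2 m1 with hbdef
  set b' := b2v l1 l2 m1 with hbdef'
  set g : ℝ → ℝ := fun y => Tstar l1 l2 m1 m2 y * iotaf l1 l2 m1 m2 y * betaf l1 l2 N y
    / (1 - η * y) with hg
  have hb : 0 < b := b1v_pos hl2
  have hb' : 0 < b' := b2v_pos hl2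
  have hbb : b' < b := b2v_lt_b1v hl1 hl2 hm1
  have hlm : l1 < m1 := by
    have : 0 < l2 / m2 := by positivity
    exact (div_lt_one hm1).1 (by linarith)
  set c := l2 / √(b * b') with hc
  set q := linPart l1 l2 m1 m2
  set B := betaPoly l1 l2 N
  let e : Polynomial ℝ := 1 - Polynomial.C η * Polynomial.X
  have he : ∀ y, e.eval y = 1 - η * y := fun y => by simp [e]
  let num : ℝ → ℝ := ((fun y => q.eval y) +
    (fun y => (Polynomial.C c).eval y) * (fun y => √(1 - b' * y)) * fun y => √(1 - b * y)) *
      fun y => B.eval y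
  have hnum : ∀ y, y ≠ 1 → 0 ≤ 1 - b * y →
      Tstar l1 l2 m1 m2 y * iotaf l1 l2 m1 m2 y * betaf l1 l2 N y = num y := by
    intro y hy hby
    rw [Tstar_mul_iotaf hm2 hsum hy (Delta_nonneg hl1 hl2 hm1 hby), sqrt_Delta hl1 hl2 hm1 hby]
    simp [num, B, q, c, eval_betaPoly, ← hbdef, ← hbdef']
  have hev1 : ∀ᶠ y in 𝓝 (0 : ℝ), y ≠ 1 := eventually_ne_nhds zero_ne_one
  have hev2 : ∀ᶠ y in 𝓝 (0 : ℝ), 0 < 1 - b * y :=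
    ContinuousAt.eventually_lt (by fun_prop) (by fun_prop) (by simp)
  have hev3 : ∀ᶠ y in 𝓝 (0 : ℝ), 0 < e.eval y :=
    ContinuousAt.eventually_lt (by fun_prop) (by fun_prop) (by simp [he])
  have haq := taylorPS_polynomial q
  have hac := taylorPS_polynomial (Polynomial.C c)
  have haB := taylorPS_polynomial B
  have hae := taylorPS_polynomial e
  have hs := taylorPS_sqrt b
  have hs' := taylorPS_sqrt b'
  have hcs := hac.1.mul hs'.1
  have hqs := haq.1.add (hcs.mul hs.1)
  have hnumA : AnalyticAt ℝ num 0 := hqs.mul haB.1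
  have hgeq : g =ᶠ[𝓝 0] fun y => num y / e.eval y := by
    filter_upwards [hev1, hev2] with y h1 h2
    rw [he, ← hnum y h1 h2.le]
  have hgA : AnalyticAt ℝ g 0 :=
    (hnumA.div hae.1 (by simp [he])).congr hgeq.symm
  refine ⟨hgA, ?_⟩
  have hge : g * (fun y => e.eval y) =ᶠ[𝓝 0] num := by
    filter_upwards [hgeq, hev3] with y h1 h2
    rw [Pi.mul_apply, h1, div_mul_cancel₀ _ h2.ne']
  have hps : taylorPS g = (q + PowerSeries.C c * sqrtPS b' * sqrtPS b) * B * geomPS η := by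
    have h := taylorPS_congr hge
    rw [taylorPS_mul hgA hae.1, hae.2, taylorPS_mul hqs haB.1, taylorPS_add haq.1 (hcs.mul hs.1),
      taylorPS_mul hcs hs.1, taylorPS_mul hac.1 hs'.1, haq.2, hac.2, haB.2, hs.2, hs'.2,
      Polynomial.coe_C] at h
    rw [sqrtPS, sqrtPS, ← h, mul_assoc]
    have he' : (e : PowerSeries ℝ) = 1 - PowerSeries.C η * PowerSeries.X := by
      simp [e]
    rw [he', geomPS_mul_one_sub, mul_one]
  have hcase : |η| < b ∨ b ≤ |η| ∧ η ≠ b ∧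
      q.eval η⁻¹ + c * √(1 - b' * η⁻¹) * √(1 - b * η⁻¹) = 0 := by
    rcases lt_or_ge |η| b with h | h
    · exact .inl h
    refine .inr ⟨h, hηb, ?_⟩
    have hT := hηc.resolve_left h.not_gt
    rw [one_div] at hT
    have h1 : η⁻¹ ≠ 1 := fun h1 => Tstar_one_ne_zero hsum hlm (h1 ▸ hT)
    have h2 : 0 ≤ 1 - b * η⁻¹ := by
      have : |b * η⁻¹| ≤ 1 := by
        rw [abs_mul, abs_inv, abs_of_pos hb, ← div_eq_mul_inv]
        exact (div_le_one (hb.trans_le h)).2 h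
      linarith [(abs_le.1 this).2]
    rw [← sqrt_Delta hl1 hl2 hm1 h2,
      ← Tstar_mul_iotaf hm2 hsum h1 (Delta_nonneg hl1 hl2 hm1 h2), hT, zero_mul]
  have hlim := hasCoeffLimit_of_sqrt_mul_sqrt q B hb' hbb hcase
  rw [← hps, HasCoeffLimit] at hlim
  have hval : b * betaf l1 l2 N (1 / b) * sigmav l1 l2 m1 η =
      (1 - η * b⁻¹)⁻¹ * (B.eval b⁻¹ * (c * √(1 - b' * b⁻¹) * (-1 / (2 * √π)))) := by
    rw [sigmav, Kcv, eval_betaPoly, ← hbdef, ← hbdef', one_div, ← div_eq_mul_inv b' b,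
      show 1 - η * b⁻¹ = -(η - b) / b by field_simp; ring, hc]
    have h1 : η - b ≠ 0 := sub_ne_zero.2 hηb
    have h2 : √(b * b') ≠ 0 := by positivity
    have h3 : √π ≠ 0 := by positivity
    generalize √(b * b') = r at h2
    generalize √(1 - b' / b) = t
    generalize η - b = d at h1
    field_simp
  rw [hval]
  simpa only [taylorPS, PowerSeries.coeff_mk] using hlim

end
end

section
/- Let λ1, λ2, μ1, μ2 > 0 with λ1+λ2+μ1+μ2 = 1 and ρ1 + ρ2 < 1, where ρ1 = λ1/μ1, ρ2 = λ2/μ2, let N ≥ 1 be an integer, and assume μ1 = μ2. Define L^{T}(y) = y·L1(y,y) + y·L2(y) + L3(y); this function is real-analytic in a neighborhood of 0. Then for every integer n ≥ N−1, its n-th Taylor coefficient at 0, (L^{T})⁽ⁿ⁾(0)/n!, equals β(1/(ρ1+ρ2))·(1−ρ1−ρ2)·(ρ1+ρ2)^n. -/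
open Real Filter Topology Set

noncomputable section

/-- For `y` near `0`, the series of `(∑_{k<N} (r y)^k) / (1 - ρ y)` in powers of `y`. -/
lemma hasSum_geom_sum_div_one_sub (r ρ : ℝ) (N : ℕ) {y : ℝ} (hy : |ρ * y| < 1) :
    HasSum (fun n => y ^ n * ∑ k ∈ Finset.range N, if k ≤ n then r ^ k * ρ ^ (n - k) else 0)
      ((∑ k ∈ Finset.range N, (r * y) ^ k) * (1 - ρ * y)⁻¹) := by
  simp_rw [Finset.mul_sum, Finset.sum_mul]
  refine hasSum_sum fun k _ => ?_
  refine ((add_left_injective k).hasSum_iff fun n hn => ?_).mp ?_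
  · have hlt : ¬ k ≤ n := fun h => hn ⟨n - k, Nat.sub_add_cancel h⟩
    simp [hlt]
  · convert! (hasSum_geometric_of_abs_lt_one hy).mul_left ((r * y) ^ k) using 2 with n
    simp only [Function.comp, Nat.le_add_left, if_true, Nat.add_sub_cancel]
    ring

lemma continuous_alphaf (l1 l2 m1 : ℝ) : Continuous (alphaf l1 l2 m1) := by
  unfold alphaf Delta
  fun_prop

/-- When both service rates equal `m`, the generating function of the total number of customers
is `L3(y) / (1 - ρ y)` with `ρ = λ1/m + λ2/m`, wherever the denominators do not vanish. -/
lemma total_eq_L3f_mul_inv {l1 l2 m y : ℝ} (N : ℕ) (hm : m ≠ 0)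
    (hD : Afun l1 l2 m y - l1 * y * alphaf l1 l2 m y ≠ 0) (hy1 : y - 1 ≠ 0)
    (hy : 1 - (l1 / m + l2 / m) * y ≠ 0) :
    y * L1f l1 l2 m m N y y + y * L2f l1 l2 m m N y + L3f l1 l2 m m N y
      = L3f l1 l2 m m N y * (1 - (l1 / m + l2 / m) * y)⁻¹ := by
  rcases eq_or_ne y 0 with rfl | hy0
  · simp
  have hE : 1 - (l1 / m + l2 / m) * y = (m - (l1 + l2) * y) / m := by field_simp
  have hE0 : m - (l1 + l2) * y ≠ 0 := by
    intro h
    simp [hE, h] at hy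
  have hK : y * Kker l1 l2 m y y = (y - 1) * (m - (l1 + l2) * y) := by
    unfold Kker
    field_simp
    ring
  unfold L1f L2f
  rw [hK, hE]
  generalize L3f l1 l2 m m N y = L
  unfold Afun at hD ⊢
  generalize alphaf l1 l2 m y = a at hD ⊢
  generalize hDdef : l1 * y + l2 * y * (1 - y) + m * (y - 1) - l1 * y * a = D at hD ⊢
  generalize hEdef : m - (l1 + l2) * y = E at hE0 ⊢
  field_simp
  rw [← hDdef, ← hEdef]
  ring

/-- A power series expansion near `0` determines the Taylor coefficients there. -/
lemma analyticAt_and_iteratedDeriv_of_hasSum {f : ℝ → ℝ} {c : ℕ → ℝ}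
    (h : ∀ᶠ y in 𝓝 0, HasSum (fun n => y ^ n * c n) (f y)) :
    AnalyticAt ℝ f 0 ∧ ∀ n, iteratedDeriv n f 0 / (Nat.factorial n : ℝ) = c n := by
  have hp : HasFPowerSeriesAt f (FormalMultilinearSeries.ofScalars ℝ c) 0 := by
    rw [hasFPowerSeriesAt_iff]
    simpa [FormalMultilinearSeries.coeff_ofScalars] using h
  refine ⟨hp.analyticAt, fun n => ?_⟩
  have := congrArg (fun p => p.coeff n)
    (hp.analyticAt.hasFPowerSeriesAt.eq_formalMultilinearSeries hp)
  simpa [FormalMultilinearSeries.coeff_ofScalars] using this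

/-- Theorem 6, case `μ1 = μ2`: the generating function of the total number of
customers is analytic at `0` and for `n ≥ N−1` its `n`-th Taylor coefficient
equals `β(1/(ρ1+ρ2))·(1−ρ1−ρ2)·(ρ1+ρ2)^n`. -/
theorem stmt19 (l1 l2 m1 m2 : ℝ) (hl1 : 0 < l1) (hl2 : 0 < l2) (hm1 : 0 < m1) (hm2 : 0 < m2)
    (hsum : l1 + l2 + m1 + m2 = 1) (hr : l1 / m1 + l2 / m2 < 1)
    (N : ℕ) (hN : 1 ≤ N) (hmu : m1 = m2) :
    AnalyticAt ℝ
      (fun y => y * L1f l1 l2 m1 m2 N y y + y * L2f l1 l2 m1 m2 N y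
        + L3f l1 l2 m1 m2 N y) 0 ∧
    ∀ n : ℕ, N - 1 ≤ n →
      iteratedDeriv n
          (fun y => y * L1f l1 l2 m1 m2 N y y + y * L2f l1 l2 m1 m2 N y
            + L3f l1 l2 m1 m2 N y) 0 / (Nat.factorial n : ℝ)
        = betaf l1 l2 N (1 / (l1 / m1 + l2 / m2)) * (1 - l1 / m1 - l2 / m2)
            * (l1 / m1 + l2 / m2) ^ n := by
  subst hmu
  set ρ : ℝ := l1 / m1 + l2 / m1 with hρ
  have hρ0 : 0 < ρ := by positivity
  set r : ℝ := l2 / (l1 + l2) with hrdef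
  set C : ℝ := (1 - l1 / m1 - l2 / m1) / ∑ k ∈ Finset.range N, (r * 1) ^ k with hC
  have hev : ∀ᶠ y in 𝓝 (0 : ℝ), HasSum
      (fun n => y ^ n *
        (C * ∑ k ∈ Finset.range N, if k ≤ n then r ^ k * ρ ^ (n - k) else 0))
      (y * L1f l1 l2 m1 m1 N y y + y * L2f l1 l2 m1 m1 N y + L3f l1 l2 m1 m1 N y) := by
    have hD : ∀ᶠ y in 𝓝 (0 : ℝ), Afun l1 l2 m1 y - l1 * y * alphaf l1 l2 m1 y ≠ 0 := by
      have hα := continuous_alphaf l1 l2 m1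
      have hc : Continuous fun y => Afun l1 l2 m1 y - l1 * y * alphaf l1 l2 m1 y := by
        unfold Afun
        fun_prop
      exact hc.continuousAt.eventually_ne (by simp [Afun, hm1.ne'])
    have hy1 : ∀ᶠ y in 𝓝 (0 : ℝ), y - 1 ≠ 0 :=
      (by fun_prop : Continuous fun y : ℝ => y - 1).continuousAt.eventually_ne (by simp)
    have hy : ∀ᶠ y in 𝓝 (0 : ℝ), |ρ * y| < 1 :=
      (by fun_prop : Continuous fun y : ℝ => |ρ * y|).continuousAt.eventually_lt_const (by simp)
    filter_upwards [hD, hy1, hy] with y hD hy1 hy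
    have hne : 1 - ρ * y ≠ 0 := by
      have := (abs_lt.mp hy).2
      linarith
    rw [total_eq_L3f_mul_inv N hm1.ne' hD hy1 hne]
    convert! (hasSum_geom_sum_div_one_sub r ρ N hy).mul_left C using 1
    · funext n
      ring
    · simp only [L3f, betaf, hC, ← hρ, ← hrdef]
      ring
  obtain ⟨han, hcoeff⟩ := analyticAt_and_iteratedDeriv_of_hasSum hev
  refine ⟨han, fun n hn => ?_⟩
  have hsum_eq : (∑ k ∈ Finset.range N, if k ≤ n then r ^ k * ρ ^ (n - k) else 0)
      = (∑ k ∈ Finset.range N, (r * (1 / ρ)) ^ k) * ρ ^ n := by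
    rw [Finset.sum_mul]
    refine Finset.sum_congr rfl fun k hk => ?_
    have hkn : k ≤ n := by
      have := Finset.mem_range.mp hk
      omega
    rw [if_pos hkn, pow_sub₀ ρ hρ0.ne' hkn, mul_pow, one_div, inv_pow]
    ring
  rw [hcoeff n, hsum_eq]
  simp only [betaf, hC, ← hrdef]
  ring

end
end
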